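/- arXiv:0804.2187 — 5 statements merged into one kernel-verified Lean document; each statement's English description precedes it below -/
import Mathlib

section
/- Let u₁, u₂, u₃ be a smooth periodic solution of the quasi-linear system. Then either (u₁, u₂, u₃) is constant on all of ℝ², or the following hold: the strictly hyperbolic region Ω_h is a union of strips parallel to the t-axis (i.e., (q,t) ∈ Ω_h iff (q,t') ∈ Ω_h for all t, t' ∈ ℝ); on Ω_h one has u₂ = 0, ∂_t u₁ = 0, ∂_t u₃ = 0; and on each connected component of Ω_h there is a constant c ∈ ℝ with u₃ = u₁² + c, so that on that component F(p,q,t) = (p²/2 + u₁(q))² + c is the square of the energy up to an additive constant. -/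
section BenneySec
open Set Filter Topology MeasureTheory
open scoped ContDiff

namespace BenneyAux

/-- gradient of `f` at `z` is `(a, b)` -/
def HP (f : ℝ × ℝ → ℝ) (z : ℝ × ℝ) (a b : ℝ) : Prop :=
  HasFDerivAt f (a • ContinuousLinearMap.fst ℝ ℝ ℝ + b • ContinuousLinearMap.snd ℝ ℝ ℝ) z

lemma clm_eq (L : ℝ × ℝ →L[ℝ] ℝ) :
    L = L (1, 0) • ContinuousLinearMap.fst ℝ ℝ ℝ + L (0, 1) • ContinuousLinearMap.snd ℝ ℝ ℝ := by
  ext <;> simp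

lemma HP.of_diff {f : ℝ × ℝ → ℝ} {z : ℝ × ℝ} (h : DifferentiableAt ℝ f z) :
    HP f z (fderiv ℝ f z (1, 0)) (fderiv ℝ f z (0, 1)) := by
  unfold HP
  rw [← clm_eq]
  exact h.hasFDerivAt

lemma HP.q {f : ℝ × ℝ → ℝ} {z : ℝ × ℝ} {a b : ℝ} (h : HP f z a b) :
    fderiv ℝ f z (1, 0) = a := by
  rw [HasFDerivAt.fderiv h]; simp

lemma HP.t {f : ℝ × ℝ → ℝ} {z : ℝ × ℝ} {a b : ℝ} (h : HP f z a b) :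
    fderiv ℝ f z (0, 1) = b := by
  rw [HasFDerivAt.fderiv h]; simp

lemma HP.unique {f : ℝ × ℝ → ℝ} {z : ℝ × ℝ} {a b c d : ℝ} (h : HP f z a b) (h' : HP f z c d) :
    a = c ∧ b = d := ⟨h.q.symm.trans h'.q, h.t.symm.trans h'.t⟩

lemma HP.to {f : ℝ × ℝ → ℝ} {z : ℝ × ℝ} {a b c d : ℝ} (h : HP f z a b) (h1 : a = c) (h2 : b = d) :
    HP f z c d := by subst h1; subst h2; exact h

lemma HP.congr {f g : ℝ × ℝ → ℝ} {z : ℝ × ℝ} {a b : ℝ} (h : HP f z a b) (e : g =ᶠ[𝓝 z] f) :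
    HP g z a b := HasFDerivAt.congr_of_eventuallyEq h e

lemma HP.const (c : ℝ) (z : ℝ × ℝ) : HP (fun _ => c) z 0 0 := by
  unfold HP; simpa using hasFDerivAt_const c z

lemma HP.add {f g : ℝ × ℝ → ℝ} {z : ℝ × ℝ} {a b c d : ℝ} (h : HP f z a b) (h' : HP g z c d) :
    HP (fun w => f w + g w) z (a + c) (b + d) := by
  unfold HP at *
  refine (h.fun_add h').congr_fderiv ?_
  ext <;> simp

lemma HP.neg {f : ℝ × ℝ → ℝ} {z : ℝ × ℝ} {a b : ℝ} (h : HP f z a b) :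
    HP (fun w => - f w) z (-a) (-b) := by
  unfold HP at *
  refine (h.fun_neg).congr_fderiv ?_
  ext <;> simp

lemma HP.sub {f g : ℝ × ℝ → ℝ} {z : ℝ × ℝ} {a b c d : ℝ} (h : HP f z a b) (h' : HP g z c d) :
    HP (fun w => f w - g w) z (a - c) (b - d) := by
  unfold HP at *
  refine (h.fun_sub h').congr_fderiv ?_
  ext <;> simp

lemma HP.mul {f g : ℝ × ℝ → ℝ} {z : ℝ × ℝ} {a b c d : ℝ} (h : HP f z a b) (h' : HP g z c d) :
    HP (fun w => f w * g w) z (a * g z + f z * c) (b * g z + f z * d) := by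
  unfold HP at *
  refine (h.fun_mul h').congr_fderiv ?_
  ext <;> simp <;> ring

lemma HP.comp {f : ℝ × ℝ → ℝ} {z : ℝ × ℝ} {a b : ℝ} {k : ℝ → ℝ} {k' : ℝ}
    (hk : HasDerivAt k k' (f z)) (h : HP f z a b) :
    HP (fun w => k (f w)) z (k' * a) (k' * b) := by
  unfold HP at *
  refine (hk.comp_hasFDerivAt z h).congr_fderiv ?_
  ext <;> simp

lemma HP.pow {f : ℝ × ℝ → ℝ} {z : ℝ × ℝ} {a b : ℝ} (h : HP f z a b) (n : ℕ) :
    HP (fun w => f w ^ n) z (n * f z ^ (n - 1) * a) (n * f z ^ (n - 1) * b) :=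
  HP.comp (hasDerivAt_pow n (f z)) h

lemma HP.inv {f : ℝ × ℝ → ℝ} {z : ℝ × ℝ} {a b : ℝ} (h : HP f z a b) (h0 : f z ≠ 0) :
    HP (fun w => (f w)⁻¹) z (-(f z ^ 2)⁻¹ * a) (-(f z ^ 2)⁻¹ * b) :=
  HP.comp (hasDerivAt_inv h0) h

/-- second derivatives commute -/
lemma HP.second {f : ℝ × ℝ → ℝ} {z : ℝ × ℝ} (h : ContDiffAt ℝ 2 f z) :
    ∃ a b c, HP (fun w => fderiv ℝ f w (1, 0)) z a b ∧ HP (fun w => fderiv ℝ f w (0, 1)) z b c := by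
  have hs : IsSymmSndFDerivAt ℝ f z := h.isSymmSndFDerivAt (by simp)
  have hd : DifferentiableAt ℝ (fderiv ℝ f) z :=
    (h.fderiv_right (m := 1) (by norm_num)).differentiableAt (by norm_num)
  have key : ∀ v : ℝ × ℝ, HP (fun w => fderiv ℝ f w v) z (fderiv ℝ (fderiv ℝ f) z (1, 0) v)
      (fderiv ℝ (fderiv ℝ f) z (0, 1) v) := by
    intro v
    have := HP.of_diff (f := fun w => fderiv ℝ f w v) (z := z)
      (hd.clm_apply (differentiableAt_const v))
    refine this.to ?_ ?_ <;>
    · rw [fderiv_clm_apply hd (differentiableAt_const v)]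
      simp
  refine ⟨_, _, _, key (1, 0), (key (0, 1)).to ?_ rfl⟩
  exact hs _ _

/-- `C¹` cutoff -/
noncomputable def phi (x : ℝ) : ℝ := (max x 0) ^ 2

lemma phi_hasDeriv (x : ℝ) : HasDerivAt phi (2 * max x 0) x := by
  rcases lt_trichotomy x 0 with h | h | h
  · have e : phi =ᶠ[𝓝 x] fun _ => 0 := by
      filter_upwards [gt_mem_nhds h] with y hy
      simp [phi, max_eq_right (le_of_lt hy)]
    rw [max_eq_right h.le]
    simpa using (hasDerivAt_const x (0:ℝ)).congr_of_eventuallyEq e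
  · subst h
    simp only [max_self, mul_zero]
    rw [hasDerivAt_iff_isLittleO_nhds_zero]
    have : (fun h : ℝ => phi (0 + h) - phi 0 - h • (0:ℝ)) =O[𝓝 0] fun h : ℝ => h ^ 2 := by
      apply Asymptotics.IsBigO.of_bound 1
      filter_upwards with y
      have h0 : phi 0 = 0 := by simp [phi]
      simp only [h0, zero_add, smul_zero, sub_zero, Real.norm_eq_abs, one_mul]
      rw [abs_of_nonneg (by unfold phi; positivity), abs_of_nonneg (by positivity)]
      unfold phi
      rcases le_total y 0 with h | h
      · rw [max_eq_right h]; nlinarith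
      · rw [max_eq_left h]
    refine this.trans_isLittleO ?_
    exact Asymptotics.isLittleO_pow_id (by norm_num)
  · have e : phi =ᶠ[𝓝 x] fun y => y ^ 2 := by
      filter_upwards [lt_mem_nhds h] with y hy
      simp [phi, max_eq_left (le_of_lt hy)]
    rw [max_eq_left h.le]
    simpa using (hasDerivAt_pow 2 x).congr_of_eventuallyEq e

lemma phi_contDiff : ContDiff ℝ 1 phi := by
  rw [contDiff_one_iff_deriv]
  refine ⟨fun x => (phi_hasDeriv x).differentiableAt, ?_⟩
  have : deriv phi = fun x => 2 * max x 0 := funext fun x => (phi_hasDeriv x).deriv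
  rw [this]
  fun_prop

lemma phi_zero {x : ℝ} (h : x ≤ 0) : phi x = 0 := by simp [phi, max_eq_right h]

def Per (f : ℝ × ℝ → ℝ) : Prop := ∀ q t, f (q + 1, t) = f (q, t) ∧ f (q, t + 1) = f (q, t)

lemma Per.fderiv {f : ℝ × ℝ → ℝ} (h : Per f) (v : ℝ × ℝ) : Per (fun w => fderiv ℝ f w v) := by
  intro q t
  constructor
  · have e : (fun w : ℝ × ℝ => f (w + (1, 0))) = f := by
      funext w; have := (h w.1 w.2).1
      simpa [Prod.add_def] using this
    have := fderiv_comp_add_right (𝕜 := ℝ) (f := f) (x := (q, t)) (1, 0)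
    rw [e] at this
    simp [this]
  · have e : (fun w : ℝ × ℝ => f (w + (0, 1))) = f := by
      funext w; have := (h w.1 w.2).2
      simpa [Prod.add_def] using this
    have := fderiv_comp_add_right (𝕜 := ℝ) (f := f) (x := (q, t)) (0, 1)
    rw [e] at this
    simp [this]

lemma div_zero_of_nonneg {A B : ℝ × ℝ → ℝ} (hA : ContDiff ℝ 1 A) (hB : ContDiff ℝ 1 B)
    (pA : Per A) (pB : Per B)
    (hpos : ∀ z, 0 ≤ fderiv ℝ B z (1, 0) + fderiv ℝ A z (0, 1)) (z : ℝ × ℝ) :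
    fderiv ℝ B z (1, 0) + fderiv ℝ A z (0, 1) = 0 := by
  have hc : Continuous (fun z => fderiv ℝ B z (1, 0) + fderiv ℝ A z (0, 1)) := by
    have h1 : Continuous (fderiv ℝ B) := hB.continuous_fderiv (by norm_num)
    have h2 : Continuous (fderiv ℝ A) := hA.continuous_fderiv (by norm_num)
    fun_prop
  obtain ⟨q, t⟩ := z
  set a : ℝ × ℝ := (q - 1/2, t - 1/2) with ha
  set b : ℝ × ℝ := (q - 1/2 + 1, t - 1/2 + 1) with hb
  have hi : IntegrableOn (fun z => fderiv ℝ B z (1, 0) + fderiv ℝ A z (0, 1)) (Icc a b) :=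
    hc.continuousOn.integrableOn_compact isCompact_Icc
  have H := integral_divergence_prod_Icc_of_hasFDerivAt_of_le B A (fderiv ℝ B) (fderiv ℝ A) a b
    (by constructor <;> simp [ha, hb]) hB.continuous.continuousOn hA.continuous.continuousOn
    (fun x _ => (hB.differentiable (by norm_num) x).hasFDerivAt)
    (fun x _ => (hA.differentiable (by norm_num) x).hasFDerivAt) hi
  have e1 : ∀ x, A (x, b.2) = A (x, a.2) := fun x => (pA x _).2
  have e2 : ∀ y, B (b.1, y) = B (a.1, y) := fun y => (pB _ y).1
  simp only [e1, e2, sub_self, zero_add] at H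
  rw [setIntegral_eq_zero_iff_of_nonneg_ae (Eventually.of_forall hpos) hi] at H
  have H2 := Measure.eqOn_of_ae_eq H hc.continuousOn continuousOn_const (by
    rw [Icc_prod_eq, interior_prod_eq, closure_prod_eq, interior_Icc, interior_Icc,
      closure_Ioo, closure_Ioo] <;> simp [ha, hb])
  exact H2 (by constructor <;> constructor <;> simp [ha, hb] <;> linarith)

lemma ext_div {A B : ℝ × ℝ → ℝ} {K : Set (ℝ × ℝ)} (hK : IsClosed K)
    (hA : ∀ z ∈ K, ContDiffAt ℝ 1 A z) (hB : ∀ z ∈ K, ContDiffAt ℝ 1 B z)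
    (hA0 : ∀ z, z ∉ K → A z = 0) (hB0 : ∀ z, z ∉ K → B z = 0)
    (pA : Per A) (pB : Per B)
    (hpos : ∀ z ∈ K, ∃ a b c d, HP A z a b ∧ HP B z c d ∧ 0 ≤ c + b)
    {z : ℝ × ℝ} {a b c d : ℝ} (h1 : HP A z a b) (h2 : HP B z c d) : c + b = 0 := by
  have ev : ∀ (A : ℝ × ℝ → ℝ), (∀ z, z ∉ K → A z = 0) → ∀ z, z ∉ K → A =ᶠ[𝓝 z] fun _ => 0 := by
    intro A h z hz
    filter_upwards [hK.isOpen_compl.mem_nhds hz] with w hw using h w hw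
  have cd : ∀ (A : ℝ × ℝ → ℝ), (∀ z ∈ K, ContDiffAt ℝ 1 A z) → (∀ z, z ∉ K → A z = 0) →
      ContDiff ℝ 1 A := by
    intro A h h0
    rw [contDiff_iff_contDiffAt]
    intro z
    by_cases hz : z ∈ K
    · exact h z hz
    · exact contDiffAt_const.congr_of_eventuallyEq (ev A h0 z hz)
  have := div_zero_of_nonneg (cd A hA hA0) (cd B hB hB0) pA pB (by
    intro z
    by_cases hz : z ∈ K
    · obtain ⟨a, b, c, d, h1, h2, h3⟩ := hpos z hz
      rw [h2.q, h1.t]; exact h3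
    · rw [((HP.const 0 z).congr (ev B hB0 z hz)).q, ((HP.const 0 z).congr (ev A hA0 z hz)).t]
      simp) z
  rwa [h2.q, h1.t] at this

lemma closed_proj {C : Set (ℝ × (ℝ × ℝ))} (hC : IsClosed C) {β : ℝ × ℝ → ℝ} (hβ : Continuous β)
    (hb : ∀ x ∈ C, |x.1| ≤ β x.2) : IsClosed {z | ∃ p, (p, z) ∈ C} := by
  rw [← isSeqClosed_iff_isClosed]
  intro zs z hzs hz
  choose p hp using hzs
  have h1 : ∀ᶠ n in atTop, p n ∈ Icc (-(β z + 1)) (β z + 1) := by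
    have : Tendsto (fun n => β (zs n)) atTop (𝓝 (β z)) := (hβ.tendsto z).comp hz
    filter_upwards [this.eventually (gt_mem_nhds (by linarith : β z < β z + 1))] with n hn
    have := abs_le.1 (hb _ (hp n))
    constructor <;> simp at * <;> linarith [this.1, this.2]
  obtain ⟨a, _, f, hf, hlim⟩ := isCompact_Icc.tendsto_subseq' h1.frequently
  refine ⟨a, ?_⟩
  refine hC.mem_of_tendsto (hlim.prodMk_nhds (hz.comp hf.tendsto_atTop)) ?_
  exact Eventually.of_forall fun n => hp (f n)

lemma root_bound {p a b : ℝ} (h : p ^ 3 + 2 * a * p + b = 0) : |p| ≤ 1 + 2 * |a| + |b| := by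
  by_contra hc
  push Not at hc
  have h1 : 1 < |p| := by linarith [abs_nonneg a, abs_nonneg b]
  have h2 : |p| ^ 3 ≤ 2 * |a| * |p| + |b| := by
    have : p ^ 3 = -(2 * a * p) + -b := by linarith
    rw [← abs_pow, this]
    refine (abs_add_le _ _).trans ?_
    rw [abs_neg, abs_neg, abs_mul, abs_mul]
    simp
  have h3 : |p| ^ 3 ≤ (2 * |a| + |b|) * |p| := by nlinarith [abs_nonneg b]
  have h4 : |p| ^ 2 ≤ 2 * |a| + |b| := by
    by_contra h5
    push Not at h5
    nlinarith
  nlinarith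

/-- smoothness of a selected simple root -/
lemma root_smooth {O : Set (ℝ × ℝ)} (hO : IsOpen O) (hS : ∀ x ∈ O, 3 * x.1 ^ 2 + 2 * x.2 ≠ 0)
    {L : ℝ × ℝ → ℝ} (hL : ∀ x ∈ O, L (x.2, -x.1 ^ 3 - 2 * x.2 * x.1) = x.1) :
    ∀ x ∈ O, ContDiffAt ℝ ∞ L (x.2, -x.1 ^ 3 - 2 * x.2 * x.1) ∧
      ∀ᶠ y in 𝓝 (x.2, -x.1 ^ 3 - 2 * x.2 * x.1), (L y, y.1) ∈ O ∧
        L y ^ 3 + 2 * y.1 * L y + y.2 = 0 := by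
  intro x hx
  set T : ℝ × ℝ → ℝ × ℝ := fun x => (x.2, -x.1 ^ 3 - 2 * x.2 * x.1) with hT
  have hTs : ContDiff ℝ ∞ T := by rw [hT]; fun_prop
  set S := 3 * x.1 ^ 2 + 2 * x.2 with hSdef
  have hS0 : S ≠ 0 := hS x hx
  let e : (ℝ × ℝ) ≃L[ℝ] (ℝ × ℝ) := ContinuousLinearEquiv.equivOfInverse
    ((ContinuousLinearMap.snd ℝ ℝ ℝ).prod
      ((-S) • ContinuousLinearMap.fst ℝ ℝ ℝ + (-2 * x.1) • ContinuousLinearMap.snd ℝ ℝ ℝ))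
    (((-2 * x.1 / S) • ContinuousLinearMap.fst ℝ ℝ ℝ + (-1 / S) • ContinuousLinearMap.snd ℝ ℝ ℝ).prod
      (ContinuousLinearMap.fst ℝ ℝ ℝ))
    (by intro v; ext <;> simp; field_simp; ring)
    (by intro v; ext <;> simp; field_simp; ring)
  have hd : HasFDerivAt T (e : (ℝ × ℝ) →L[ℝ] (ℝ × ℝ)) x := by
    have h1 : HasFDerivAt (fun x : ℝ × ℝ => x.1) (ContinuousLinearMap.fst ℝ ℝ ℝ) x :=
      hasFDerivAt_fst
    have h2 : HasFDerivAt (fun x : ℝ × ℝ => x.2) (ContinuousLinearMap.snd ℝ ℝ ℝ) x :=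
      hasFDerivAt_snd
    have h3 := h2.prodMk ((((hasDerivAt_pow 3 x.1).comp_hasFDerivAt x h1).fun_neg).fun_sub ((h2.const_mul 2).fun_mul h1))
    refine h3.congr_fderiv ?_
    ext <;> simp [e] <;> ring
  have hcd : ContDiffAt ℝ ∞ T x := hTs.contDiffAt
  have hn : (∞ : WithTop ℕ∞) ≠ 0 := by simp
  have hst := hcd.hasStrictFDerivAt' hd hn
  have hg := hcd.to_localInverse hd hn
  have ev1 : ∀ᶠ y in 𝓝 (T x), T (hcd.localInverse hd hn y) = y := hst.eventually_right_inverse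
  have ev2 : ∀ᶠ y in 𝓝 (T x), hcd.localInverse hd hn y ∈ O :=
    hst.localInverse_tendsto.eventually (hO.mem_nhds hx)
  have ev3 : ∀ᶠ y in 𝓝 (T x), L y = (hcd.localInverse hd hn y).1 := by
    filter_upwards [ev1, ev2] with y h1 h2
    have := hL _ h2
    rw [← this]
    exact congrArg L h1.symm
  refine ⟨?_, ?_⟩
  · exact (contDiffAt_fst.comp (T x) hg).congr_of_eventuallyEq ev3
  · filter_upwards [ev1, ev2, ev3] with y h1 h2 h3
    have h4 : (hcd.localInverse hd hn y).2 = y.1 := congrArg Prod.fst h1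
    have h5 := congrArg Prod.snd h1
    simp only [hT] at h5
    rw [h4, ← h3] at h5
    refine ⟨?_, by linarith⟩
    rw [h3, ← h4]
    exact h2


lemma two_le_inf : (2 : WithTop ℕ∞) ≤ ∞ := WithTop.coe_le_coe.2 (le_top : (2 : ℕ∞) ≤ ⊤)

structure Sol (u1 u2 u3 x1 x2 x3 : ℝ × ℝ → ℝ) : Prop where
  c1 : ContDiff ℝ ∞ u1
  c2 : ContDiff ℝ ∞ u2
  c3 : ContDiff ℝ ∞ u3
  cx1 : ContDiff ℝ ∞ x1
  cx2 : ContDiff ℝ ∞ x2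
  cx3 : ContDiff ℝ ∞ x3
  p1 : Per u1
  p2 : Per u2
  p3 : Per u3
  px1 : Per x1
  px2 : Per x2
  px3 : Per x3
  h1 : ∀ z, HP u1 z (x1 z) (-x2 z)
  h2 : ∀ z, HP u2 z (x2 z) (2 * u1 z * x1 z - x3 z)
  h3 : ∀ z, HP u3 z (x3 z) (u2 z * x1 z)
  hx : ∀ z, ∃ s1 s2 s3, HP x1 z s1 (-s2) ∧ HP x2 z s2 (2 * x1 z ^ 2 + 2 * u1 z * s1 - s3) ∧
    HP x3 z s3 (x2 z * x1 z + u2 z * s1)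

structure Good (O : Set (ℝ × ℝ)) : Prop where
  op : IsOpen O
  ne : ∀ x ∈ O, 3 * x.1 ^ 2 + 2 * x.2 ≠ 0
  uniq : ∀ p p' a : ℝ, (p, a) ∈ O → (p', a) ∈ O → p ^ 3 + 2 * a * p = p' ^ 3 + 2 * a * p' → p = p'

open Classical in
/-- the root selected by `O` -/
noncomputable def sel (O : Set (ℝ × ℝ)) (a b : ℝ) : ℝ :=
  if h : ∃ p, (p, a) ∈ O ∧ p ^ 3 + 2 * a * p + b = 0 then h.choose else 0

lemma sel_eq {O : Set (ℝ × ℝ)} (hO : Good O) {p a b : ℝ} (h : (p, a) ∈ O)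
    (h' : p ^ 3 + 2 * a * p + b = 0) : sel O a b = p := by
  have hex : ∃ p, (p, a) ∈ O ∧ p ^ 3 + 2 * a * p + b = 0 := ⟨p, h, h'⟩
  unfold sel
  rw [dif_pos hex]
  have := hex.choose_spec
  exact hO.uniq _ _ a this.1 h (by linarith [this.2])

lemma sel_spec {O : Set (ℝ × ℝ)} {a b : ℝ} (h : sel O a b ≠ 0) :
    (sel O a b, a) ∈ O ∧ sel O a b ^ 3 + 2 * a * sel O a b + b = 0 := by
  by_cases hex : ∃ p, (p, a) ∈ O ∧ p ^ 3 + 2 * a * p + b = 0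
  · unfold sel
    rw [dif_pos hex]
    exact hex.choose_spec
  · exact absurd (by unfold sel; rw [dif_neg hex]) h

section
variable {u1 u2 u3 x1 x2 x3 : ℝ × ℝ → ℝ}

lemma sel_loc (hs : Sol u1 u2 u3 x1 x2 x3) {O : Set (ℝ × ℝ)} (hO : Good O) {z : ℝ × ℝ} {p : ℝ}
    (h : (p, u1 z) ∈ O) (h' : p ^ 3 + 2 * u1 z * p + u2 z = 0) :
    sel O (u1 z) (u2 z) = p ∧ ContDiffAt ℝ ∞ (fun w => sel O (u1 w) (u2 w)) z ∧
    (∀ᶠ w in 𝓝 z, (sel O (u1 w) (u2 w), u1 w) ∈ O ∧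
      sel O (u1 w) (u2 w) ^ 3 + 2 * u1 w * sel O (u1 w) (u2 w) + u2 w = 0) ∧
    HP (fun w => sel O (u1 w) (u2 w)) z (-(2 * p * x1 z + x2 z) / (3 * p ^ 2 + 2 * u1 z))
      ((2 * p * x2 z - 2 * u1 z * x1 z + x3 z) / (3 * p ^ 2 + 2 * u1 z)) := by
  have e := sel_eq hO h h'
  have hS := hO.ne _ h
  simp only at hS
  obtain ⟨r1, r2⟩ := root_smooth hO.op hO.ne (L := fun y => sel O y.1 y.2)
    (fun x hx => sel_eq hO hx (by ring)) _ h
  simp only at r1 r2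
  have e2 : -p ^ 3 - 2 * u1 z * p = u2 z := by linarith
  rw [e2] at r1 r2
  have cp : ContDiffAt ℝ ∞ (fun w => (u1 w, u2 w)) z := (hs.c1.contDiffAt).prodMk hs.c2.contDiffAt
  have cl : ContDiffAt ℝ ∞ (fun w => sel O (u1 w) (u2 w)) z :=
    ContDiffAt.comp (g := fun y : ℝ × ℝ => sel O y.1 y.2) z r1 cp
  have ev : ∀ᶠ w in 𝓝 z, (sel O (u1 w) (u2 w), u1 w) ∈ O ∧
      sel O (u1 w) (u2 w) ^ 3 + 2 * u1 w * sel O (u1 w) (u2 w) + u2 w = 0 :=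
    cp.continuousAt.eventually r2
  refine ⟨e, cl, ev, ?_⟩
  have hl := HP.of_diff (cl.differentiableAt (by simp))
  have hf := (((hl.pow 3).add (((HP.const 2 z).mul (hs.h1 z)).mul hl)).add (hs.h2 z))
  have h0 : HP (fun w => sel O (u1 w) (u2 w) ^ 3 + 2 * u1 w * sel O (u1 w) (u2 w) + u2 w) z 0 0 :=
    (HP.const 0 z).congr (ev.mono fun w hw => hw.2)
  obtain ⟨q1, q2⟩ := hf.unique h0
  simp only [e] at q1 q2
  push_cast at q1 q2
  refine hl.to ?_ ?_
  · rw [eq_div_iff hS]; linear_combination q1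
  · rw [eq_div_iff hS]; linear_combination q2

/-- largest root -/
def O1 : Set (ℝ × ℝ) := {x | 0 < x.1 ∧ 0 < 3 * x.1 ^ 2 + 2 * x.2}
/-- middle root -/
def O3 : Set (ℝ × ℝ) := {x | 3 * x.1 ^ 2 + 2 * x.2 < 0}

lemma good1 : Good O1 where
  op := by
    have h1 : IsOpen {x : ℝ × ℝ | 0 < x.1} := isOpen_lt continuous_const continuous_fst
    have h2 : IsOpen {x : ℝ × ℝ | 0 < 3 * x.1 ^ 2 + 2 * x.2} :=
      isOpen_lt continuous_const (by fun_prop)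
    exact h1.inter h2
  ne := fun x hx => hx.2.ne'
  uniq := by
    rintro p p' a ⟨h1, h2⟩ ⟨h3, h4⟩ h
    simp only at h1 h2 h3 h4
    by_contra hne
    have : (p - p') * (p ^ 2 + p * p' + p' ^ 2 + 2 * a) = 0 := by linear_combination h
    rcases mul_eq_zero.1 this with h5 | h5
    · exact hne (by linarith)
    · rcases lt_or_gt_of_ne hne with h6 | h6 <;> nlinarith [mul_pos h1 h3]

lemma good3 : Good O3 where
  op := isOpen_lt (by fun_prop) continuous_const
  ne := fun x hx => ne_of_lt hx
  uniq := by
    rintro p p' a h1 h2 h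
    change 3 * p ^ 2 + 2 * a < 0 at h1
    change 3 * p' ^ 2 + 2 * a < 0 at h2
    by_contra hne
    have : (p - p') * (p ^ 2 + p * p' + p' ^ 2 + 2 * a) = 0 := by linear_combination h
    rcases mul_eq_zero.1 this with h5 | h5
    · exact hne (by linarith)
    · nlinarith [sq_nonneg (p - p')]

lemma Per.comp2 {f g : ℝ × ℝ → ℝ} (hf : Per f) (hg : Per g) (k : ℝ → ℝ → ℝ) :
    Per (fun w => k (f w) (g w)) := by
  intro q t
  simp only [(hf q t).1, (hf q t).2, (hg q t).1, (hg q t).2, and_self]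

lemma bound_cont (hs : Sol u1 u2 u3 x1 x2 x3) :
    Continuous (fun w => 1 + 2 * |u1 w| + |u2 w|) := by
  have := hs.c1.continuous
  have := hs.c2.continuous
  fun_prop

lemma step1 (hs : Sol u1 u2 u3 x1 x2 x3) {z : ℝ × ℝ} {p : ℝ} (hp : 0 < p)
    (hr : p ^ 3 + 2 * u1 z * p + u2 z = 0) (hb : 0 < 2 * u1 z + 3 / 4 * p ^ 2) :
    x2 z = p * x1 z ∧ x3 z = (2 * u1 z + p ^ 2) * x1 z := by
  set l : ℝ × ℝ → ℝ := fun w => sel O1 (u1 w) (u2 w) with hl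
  have pl : Per l := hs.p1.comp2 hs.p2 _
  set b : ℝ × ℝ → ℝ := fun w => 2 * u1 w + 3 / 4 * l w ^ 2 with hbdef
  have pb : Per b := hs.p1.comp2 pl fun u l => 2 * u + 3 / 4 * l ^ 2
  set R : ℝ × ℝ → ℝ := fun w => (l w ^ 2 * b w * (1/2) + u3 w) - (2 * u1 w + l w ^ 2) * u1 w * (1/2)
    with hR
  have pR : Per R := Per.comp2 (Per.comp2 (Per.comp2 pl pb fun l b => l ^ 2 * b * (1/2)) hs.p3
    fun a b => a + b) (Per.comp2 hs.p1 pl fun u l => (2 * u + l ^ 2) * u * (1/2)) fun a b => a - b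
  set V : ℝ × ℝ → ℝ := fun w => l w ^ 2 * b w ^ 3 with hV
  have pV : Per V := Per.comp2 pl pb fun l b => l ^ 2 * b ^ 3
  -- local information at a point
  have loc : ∀ w r, 0 < r → r ^ 3 + 2 * u1 w * r + u2 w = 0 → 0 < 2 * u1 w + 3 / 4 * r ^ 2 →
      l w = r ∧ ContDiffAt ℝ ∞ R w ∧ ContDiffAt ℝ ∞ V w ∧ ∃ Rq Rt Vq Vt, HP R w Rq Rt ∧ HP V w Vq Vt ∧
        Rq * Vt - Rt * Vq = Vq ^ 2 / (2 * r * (2 * u1 w + 3 / 4 * r ^ 2)) +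
          2 * r * (2 * u1 w + 3 / 4 * r ^ 2) ^ 2 * Rq ^ 2 ∧
        (Rq = 0 → Vq = 0 → x2 w = r * x1 w ∧ x3 w = (2 * u1 w + r ^ 2) * x1 w) := by
    intro w r hr0 hrr hbr
    have hS : 0 < 3 * r ^ 2 + 2 * u1 w := by nlinarith
    obtain ⟨e, cl, ev, hl'⟩ := sel_loc hs good1 (z := w) (p := r) ⟨hr0, hS⟩ hrr
    change l w = r at e
    change ContDiffAt ℝ ∞ l w at cl
    change HP l w _ _ at hl'
    have c1 := hs.c1.contDiffAt (x := w)
    have c3 := hs.c3.contDiffAt (x := w)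
    have cb : ContDiffAt ℝ ∞ b w := by rw [hbdef]; fun_prop
    refine ⟨e, by rw [hR]; fun_prop, by rw [hV]; fun_prop, ?_⟩
    have hb' : HP b w _ _ := ((HP.const 2 w).mul (hs.h1 w)).add ((HP.const (3/4) w).mul (hl'.pow 2))
    have hR' : HP R w _ _ := ((((hl'.pow 2).mul hb').mul (HP.const (1/2) w)).add (hs.h3 w)).sub
      (((((HP.const 2 w).mul (hs.h1 w)).add (hl'.pow 2)).mul (hs.h1 w)).mul (HP.const (1/2) w))
    have hV' : HP V w _ _ := (hl'.pow 2).mul (hb'.pow 3)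
    refine ⟨_, _, _, _, hR', hV', ?_, ?_⟩
    · have hbw : b w = 2 * u1 w + 3 / 4 * r ^ 2 := by rw [hbdef]; simp only [e]
      have hu2 : u2 w = -r ^ 3 - 2 * u1 w * r := by linarith
      obtain ⟨B, hB⟩ : ∃ B, B = 2 * u1 w + 3 / 4 * r ^ 2 := ⟨_, rfl⟩
      have hu1 : u1 w = (B - 3 / 4 * r ^ 2) / 2 := by rw [hB]; ring
      have hB0 : B ≠ 0 := by rw [hB]; exact hbr.ne'
      have hS' : 3 * r ^ 2 + (B - 3 / 4 * r ^ 2) ≠ 0 := by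
        rw [hB]; intro h; linarith
      simp only [hbw, e, hu2, ← hB]
      rw [hu1]
      have hr1 := hr0.ne'
      push_cast
      have e3 : 3 * r ^ 2 + 2 * ((B - 3 / 4 * r ^ 2) / 2) = B + 9 / 4 * r ^ 2 := by ring
      have hS2 : B + 9 / 4 * r ^ 2 ≠ 0 := by intro h; apply hS'; linarith
      simp only [e3]
      generalize hD : (B + 9 / 4 * r ^ 2) = D at *
      have hr2 : r ^ 2 = 4 / 9 * (D - B) := by linarith
      field_simp
      rw [← hD]
      ring
    · intro hRq hVq
      have hbw : b w = 2 * u1 w + 3 / 4 * r ^ 2 := by rw [hbdef]; simp only [e]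
      simp only [hbw, e] at hRq hVq
      push_cast at hRq hVq
      obtain ⟨Q, hQ⟩ : ∃ Q, Q = -(2 * r * x1 w + x2 w) / (3 * r ^ 2 + 2 * u1 w) := ⟨_, rfl⟩
      rw [← hQ] at hRq hVq
      rw [eq_div_iff hS.ne'] at hQ
      have k1 : x2 w = r * x1 w := by
        have hz : (r * (2 * u1 w + 3 / 4 * r ^ 2) ^ 2) * (x2 w - r * x1 w) = 0 := by
          linear_combination (-1/2) * hVq + r * (2 * u1 w + 3 / 4 * r ^ 2) ^ 2 * hQ
        rcases mul_eq_zero.1 hz with h | h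
        · exact absurd h (by positivity)
        · linarith
      refine ⟨k1, ?_⟩
      rw [k1] at hQ
      linear_combination hRq - r / 2 * hQ
  obtain ⟨lz, cRz, cVz, Rq, Rt, Vq, Vt, hRz, hVz, idz, finz⟩ := loc z p hp hr hb
  have hVpos : 0 < V z := by
    have : b z = 2 * u1 z + 3 / 4 * p ^ 2 := by simp only [hbdef, lz]
    simp only [hV, lz, this]; positivity
  set ε := V z / 2 with hε
  have hε0 : 0 < ε := by rw [hε]; linarith
  set C : Set (ℝ × (ℝ × ℝ)) := {x | 0 ≤ x.1 ∧ x.1 ^ 3 + 2 * u1 x.2 * x.1 + u2 x.2 = 0 ∧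
    0 ≤ 2 * u1 x.2 + 3 / 4 * x.1 ^ 2 ∧ ε ≤ x.1 ^ 2 * (2 * u1 x.2 + 3 / 4 * x.1 ^ 2) ^ 3} with hC
  have cu1 := hs.c1.continuous
  have cu2 := hs.c2.continuous
  have hCc : IsClosed C := by
    have k1 : IsClosed {x : ℝ × (ℝ × ℝ) | 0 ≤ x.1} := isClosed_le (by fun_prop) (by fun_prop)
    have k2 : IsClosed {x : ℝ × (ℝ × ℝ) | x.1 ^ 3 + 2 * u1 x.2 * x.1 + u2 x.2 = 0} :=
      isClosed_eq (by fun_prop) (by fun_prop)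
    have k3 : IsClosed {x : ℝ × (ℝ × ℝ) | 0 ≤ 2 * u1 x.2 + 3 / 4 * x.1 ^ 2} :=
      isClosed_le (by fun_prop) (by fun_prop)
    have k4 : IsClosed {x : ℝ × (ℝ × ℝ) | ε ≤ x.1 ^ 2 * (2 * u1 x.2 + 3 / 4 * x.1 ^ 2) ^ 3} :=
      isClosed_le (by fun_prop) (by fun_prop)
    exact k1.inter (k2.inter (k3.inter k4))
  have hK := closed_proj hCc (bound_cont hs) (fun x hx => root_bound hx.2.1)
  set K : Set (ℝ × ℝ) := {w | ∃ r, (r, w) ∈ C} with hKdef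
  have inK : ∀ w ∈ K, ∃ r, 0 < r ∧ r ^ 3 + 2 * u1 w * r + u2 w = 0 ∧
      0 < 2 * u1 w + 3 / 4 * r ^ 2 := by
    rintro w ⟨r, h1, h2, h3, h4⟩
    simp only at h1 h2 h3 h4
    refine ⟨r, lt_of_le_of_ne h1 ?_, h2, lt_of_le_of_ne h3 ?_⟩
    · rintro rfl; simp at h4; linarith
    · intro h; rw [← h] at h4; simp at h4; linarith
  have offK : ∀ w, w ∉ K → phi (V w - ε) = 0 := by
    intro w hw
    apply phi_zero
    by_contra hcon
    push Not at hcon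
    have hVw : ε < V w := by linarith
    have hl0 : l w ≠ 0 := by
      intro h
      simp only [hV, h] at hVw
      simp at hVw; linarith
    obtain ⟨⟨m1, m2⟩, m3⟩ := sel_spec hl0
    simp only at m1 m2
    have hbw : 0 < b w := by
      by_contra hn
      push Not at hn
      have : b w ^ 3 ≤ 0 := by
        have := mul_nonneg (sq_nonneg (b w)) (neg_nonneg.2 hn)
        nlinarith
      have : V w ≤ 0 := by
        simp only [hV]; nlinarith [sq_nonneg (l w)]
      linarith
    exact hw ⟨l w, m1.le, m3, hbw.le, hVw.le⟩
  set A : ℝ × ℝ → ℝ := fun w => fderiv ℝ R w (1, 0) * phi (V w - ε) with hA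
  set B : ℝ × ℝ → ℝ := fun w => -(fderiv ℝ R w (0, 1) * phi (V w - ε)) with hB
  have pΦ : Per (fun w => phi (V w - ε)) := Per.comp2 pV pV fun v _ => phi (v - ε)
  have main : ∀ w Rq Rt Vq Vt, ContDiffAt ℝ ∞ R w → HP R w Rq Rt → HP V w Vq Vt →
      ∃ a b c d, HP A w a b ∧ HP B w c d ∧ c + b = 2 * max (V w - ε) 0 * (Rq * Vt - Rt * Vq) := by
    intro w Rq Rt Vq Vt cR h1 h2
    obtain ⟨a, b, c, s1, s2⟩ := HP.second (cR.of_le two_le_inf)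
    have hΦ : HP (fun w => phi (V w - ε)) w _ _ :=
      HP.comp (phi_hasDeriv (V w - ε)) (h2.sub (HP.const ε w))
    refine ⟨_, _, _, _, s1.mul hΦ, (s2.mul hΦ).neg, ?_⟩
    rw [h1.q, h1.t]
    ring
  obtain ⟨a', b', c', d', hA', hB', e'⟩ := main z Rq Rt Vq Vt cRz hRz hVz
  have cΦ : ∀ w, ContDiffAt ℝ ∞ V w → ContDiffAt ℝ 1 (fun w => phi (V w - ε)) w := by
    intro w h
    exact phi_contDiff.contDiffAt.comp w ((h.of_le (by exact_mod_cast le_top)).sub contDiffAt_const)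
  have cF : ∀ w v, ContDiffAt ℝ ∞ R w → ContDiffAt ℝ 1 (fun w => fderiv ℝ R w v) w := by
    intro w v h
    exact (h.fderiv_right (m := 1) (by rw [one_add_one_eq_two]; exact two_le_inf)).clm_apply contDiffAt_const
  have fin := ext_div hK (A := A) (B := B)
    (by
      intro w hw
      obtain ⟨r, r1, r2, r3⟩ := inK w hw
      obtain ⟨-, cR, cV, -⟩ := loc w r r1 r2 r3
      exact (cF w _ cR).mul (cΦ w cV))
    (by
      intro w hw
      obtain ⟨r, r1, r2, r3⟩ := inK w hw
      obtain ⟨-, cR, cV, -⟩ := loc w r r1 r2 r3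
      exact ((cF w _ cR).mul (cΦ w cV)).neg)
    (by intro w hw; simp only [hA, offK w hw, mul_zero])
    (by intro w hw; simp only [hB, offK w hw, mul_zero, neg_zero])
    (Per.comp2 (pR.fderiv _) pΦ fun a b => a * b)
    (Per.comp2 (pR.fderiv _) pΦ fun a b => -(a * b))
    (by
      intro w hw
      obtain ⟨r, r1, r2, r3⟩ := inK w hw
      obtain ⟨-, cR, cV, Rq, Rt, Vq, Vt, h1, h2, h3, -⟩ := loc w r r1 r2 r3
      obtain ⟨a, b, c, d, k1, k2, k3⟩ := main w Rq Rt Vq Vt cR h1 h2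
      refine ⟨a, b, c, d, k1, k2, ?_⟩
      rw [k3, h3]
      positivity)
    hA' hB'
  rw [e', idz, max_eq_left (by rw [hε]; linarith)] at fin
  have hpos : 0 < 2 * (V z - ε) := by rw [hε]; linarith
  have fin2 := (mul_eq_zero.1 fin).resolve_left hpos.ne'
  have n1 : 0 ≤ Vq ^ 2 / (2 * p * (2 * u1 z + 3 / 4 * p ^ 2)) := by positivity
  have n2 : 0 ≤ 2 * p * (2 * u1 z + 3 / 4 * p ^ 2) ^ 2 * Rq ^ 2 := by positivity
  have m1 : Vq ^ 2 / (2 * p * (2 * u1 z + 3 / 4 * p ^ 2)) = 0 := by linarith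
  have m2 : 2 * p * (2 * u1 z + 3 / 4 * p ^ 2) ^ 2 * Rq ^ 2 = 0 := by linarith
  apply finz
  · have := (mul_eq_zero.1 m2).resolve_left (by positivity)
    exact pow_eq_zero_iff (two_ne_zero) |>.1 this
  · have := (div_eq_zero_iff.1 m1).resolve_right (by positivity)
    exact pow_eq_zero_iff (two_ne_zero) |>.1 this
end


section
variable {u1 u2 u3 x1 x2 x3 : ℝ × ℝ → ℝ}

lemma step2 (hs : Sol u1 u2 u3 x1 x2 x3) {z : ℝ × ℝ} {p : ℝ} (hp : 0 < p)
    (hr : p ^ 3 + 2 * u1 z * p + u2 z = 0) (hb : 2 * u1 z + 3 / 4 * p ^ 2 ≤ 0)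
    (hS : 0 < 3 * p ^ 2 + 2 * u1 z) :
    x1 z * p ^ 2 + x2 z * p + x3 z = 0 := by
  by_contra hy0
  set l : ℝ × ℝ → ℝ := fun w => sel O1 (u1 w) (u2 w) with hl
  have pl : Per l := hs.p1.comp2 hs.p2 _
  set b : ℝ × ℝ → ℝ := fun w => 2 * u1 w + 3 / 4 * l w ^ 2 with hbdef
  have pb : Per b := hs.p1.comp2 pl fun u l => 2 * u + 3 / 4 * l ^ 2
  set y : ℝ × ℝ → ℝ := fun w => x1 w * l w ^ 2 + x2 w * l w + x3 w with hy
  have py : Per y := Per.comp2 (Per.comp2 (Per.comp2 hs.px1 pl fun x l => x * l ^ 2)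
    (Per.comp2 hs.px2 pl fun x l => x * l) fun a b => a + b) hs.px3 fun a b => a + b
  set S : ℝ × ℝ → ℝ := fun w => 3 * l w ^ 2 + 2 * u1 w with hSdef
  have pS : Per S := Per.comp2 pl hs.p1 fun l u => 3 * l ^ 2 + 2 * u
  set W : ℝ × ℝ → ℝ := fun w => S w * y w ^ 2 with hW
  have pW : Per W := Per.comp2 pS py fun S y => S * y ^ 2
  set θ : ℝ × ℝ → ℝ := fun w => Real.smoothTransition (2 - b w * (l w ^ 2)⁻¹) with hθ
  have pθ : Per θ := Per.comp2 pb pl fun b l => Real.smoothTransition (2 - b * (l ^ 2)⁻¹)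
  have lz : l z = p := (sel_loc hs good1 (z := z) ⟨hp, hS⟩ hr).1
  have hWz : 0 < W z := by
    simp only [hW, hSdef, hy, lz]
    positivity
  obtain ⟨ε, hε⟩ : ∃ ε, ε = W z / 2 := ⟨_, rfl⟩
  have hε0 : 0 < ε := by rw [hε]; linarith
  set g : ℝ × ℝ → ℝ := fun w => θ w * y w * phi (W w - ε) with hg
  have pg : Per g := Per.comp2 (Per.comp2 pθ py fun a b => a * b) pW fun a b => a * phi (b - ε)
  -- local information
  have loc : ∀ w r, 0 < r → r ^ 3 + 2 * u1 w * r + u2 w = 0 → 0 < 3 * r ^ 2 + 2 * u1 w →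
      l w = r ∧ ContDiffAt ℝ ∞ l w ∧ ContDiffAt ℝ 1 g w ∧ (∀ᶠ v in 𝓝 w, 0 < l v) ∧
      ∃ lq lt gq gt, HP l w lq lt ∧ HP g w gq gt ∧
        gt + l w * gq + lq * g w = θ w * (2 * max (W w - ε) 0) * (6 * r * y w ^ 4 / S w) := by
    intro w r hr0 hrr hSr
    obtain ⟨e, cl, ev, hl'⟩ := sel_loc hs good1 (z := w) (p := r) ⟨hr0, hSr⟩ hrr
    change l w = r at e
    change ContDiffAt ℝ ∞ l w at cl
    change HP l w _ _ at hl'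
    have hSw : S w = 3 * r ^ 2 + 2 * u1 w := by simp only [hSdef, e]
    have hyw : y w = x1 w * r ^ 2 + x2 w * r + x3 w := by simp only [hy, e]
    have hlw : l w ≠ 0 := by rw [e]; exact hr0.ne'
    have c1 := hs.c1.contDiffAt (x := w)
    have d1 := hs.cx1.contDiffAt (x := w)
    have d2 := hs.cx2.contDiffAt (x := w)
    have d3 := hs.cx3.contDiffAt (x := w)
    have cb : ContDiffAt ℝ ∞ b w := by rw [hbdef]; fun_prop
    have cy : ContDiffAt ℝ ∞ y w := by rw [hy]; fun_prop
    have cS : ContDiffAt ℝ ∞ S w := by rw [hSdef]; fun_prop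
    have cW : ContDiffAt ℝ ∞ W w := by rw [hW]; fun_prop
    have cθ : ContDiffAt ℝ ∞ θ w := by
      have : ContDiffAt ℝ ∞ (fun w => 2 - b w * (l w ^ 2)⁻¹) w :=
        contDiffAt_const.sub (cb.mul ((cl.pow 2).inv (pow_ne_zero 2 hlw)))
      exact Real.smoothTransition.contDiffAt.comp w this
    have one_le : (1 : WithTop ℕ∞) ≤ ∞ := le_trans (by norm_num) two_le_inf
    have cg : ContDiffAt ℝ 1 g w :=
      ((cθ.of_le one_le).mul (cy.of_le one_le)).mul
        (phi_contDiff.contDiffAt.comp w ((cW.of_le one_le).sub contDiffAt_const))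
    refine ⟨e, cl, cg, ev.mono fun v hv => hv.1.1, ?_⟩
    -- the cutoff is invariant
    have hθ' : ∃ a c, HP θ w a c ∧ c + r * a = 0 := by
      by_cases hbw : b w < l w ^ 2
      · refine ⟨0, 0, (HP.const 1 w).congr ?_, by ring⟩
        have hev : ∀ᶠ v in 𝓝 w, b v < l v ^ 2 :=
          cb.continuousAt.eventually_lt (cl.continuousAt.pow 2) hbw
        filter_upwards [hev, ev] with v hv1 hv2
        apply Real.smoothTransition.one_of_one_le
        have hlv : 0 < l v ^ 2 := pow_pos hv2.1.1 2
        have : b v * (l v ^ 2)⁻¹ < 1 := by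
          rw [← div_eq_mul_inv, div_lt_one hlv]; exact hv1
        linarith
      · push Not at hbw
        have hb0 : 0 < 2 * u1 w + 3 / 4 * r ^ 2 := by
          simp only [hbdef, e] at hbw
          have : 0 < r ^ 2 := by positivity
          linarith
        obtain ⟨k1, k2⟩ := step1 hs hr0 hrr hb0
        have hb' : HP b w _ _ :=
          ((HP.const 2 w).mul (hs.h1 w)).add ((HP.const (3/4) w).mul (hl'.pow 2))
        have hin := (HP.const 2 w).sub (hb'.mul ((hl'.pow 2).inv (pow_ne_zero 2 hlw)))
        have hd : HasDerivAt Real.smoothTransition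
            (deriv Real.smoothTransition (2 - b w * (l w ^ 2)⁻¹)) (2 - b w * (l w ^ 2)⁻¹) :=
          ((Real.smoothTransition.contDiff (n := 1)).differentiable (by norm_num) _).hasDerivAt
        have hθ2 : HP θ w _ _ := HP.comp hd hin
        refine ⟨_, _, hθ2, ?_⟩
        have q1 : -(2 * r * x1 w + x2 w) / (3 * r ^ 2 + 2 * u1 w)
            = -(3 * r * x1 w) / (3 * r ^ 2 + 2 * u1 w) := by rw [k1]; ring
        have q2 : (2 * r * x2 w - 2 * u1 w * x1 w + x3 w) / (3 * r ^ 2 + 2 * u1 w)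
            = -r * (-(3 * r * x1 w) / (3 * r ^ 2 + 2 * u1 w)) := by rw [k1, k2]; ring
        rw [q1, q2, k1, e]
        ring
    obtain ⟨θq, θt, hθ'', inv⟩ := hθ'
    obtain ⟨s1, s2, s3, g1, g2, g3⟩ := hs.hx w
    have hy' : HP y w _ _ := ((g1.mul (hl'.pow 2)).add (g2.mul hl')).add g3
    have hS' : HP S w _ _ := ((HP.const 3 w).mul (hl'.pow 2)).add ((HP.const 2 w).mul (hs.h1 w))
    obtain ⟨Q, hQ⟩ : ∃ Q, Q = -(2 * r * x1 w + x2 w) / (3 * r ^ 2 + 2 * u1 w) := ⟨_, rfl⟩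
    obtain ⟨P, hP⟩ : ∃ P, P = (2 * r * x2 w - 2 * u1 w * x1 w + x3 w) / (3 * r ^ 2 + 2 * u1 w) :=
      ⟨_, rfl⟩
    rw [← hQ, ← hP] at hl' hy' hS'
    rw [eq_div_iff hSr.ne'] at hQ hP
    obtain ⟨yq, yt, hy'', ydyn⟩ : ∃ a c, HP y w a c ∧ c + r * a = -(Q * y w) := by
      refine ⟨_, _, hy', ?_⟩
      apply mul_right_cancel₀ hSr.ne'
      rw [hyw]
      have hu2 : u2 w = -r ^ 3 - 2 * u1 w * r := by linarith
      rw [e, hu2]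
      push_cast
      linear_combination (2 * x1 w * r + x2 w) * hP + (2 * x1 w * r ^ 2 + 2 * x2 w * r + x1 w * r ^ 2 + x3 w) * hQ
    obtain ⟨Sq, St, hS'', Sdyn⟩ : ∃ a c, HP S w a c ∧
        (c + r * a) * S w = 2 * Q * S w ^ 2 + 6 * r * y w := by
      refine ⟨_, _, hS', ?_⟩
      rw [hyw, hSw, e]
      push_cast
      linear_combination 6 * r * hP + (6 * r ^ 2 - 2 * (3 * r ^ 2 + 2 * u1 w)) * hQ
    have hW' : HP W w _ _ := hS''.mul (hy''.pow 2)
    have hΦ : HP (fun w => phi (W w - ε)) w _ _ :=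
      HP.comp (phi_hasDeriv (W w - ε)) (hW'.sub (HP.const ε w))
    have hg' : HP g w _ _ := (hθ''.mul hy'').mul hΦ
    refine ⟨_, _, _, _, hl', hg', ?_⟩
    have hS0 : S w ≠ 0 := by rw [hSw]; exact hSr.ne'
    have gw : g w = θ w * y w * phi (W w - ε) := rfl
    rw [gw, e]
    have hθt : θt = - r * θq := by linarith
    have hyt : yt = -(Q * y w) - r * yq := by linarith
    have hSt : St = (2 * Q * S w ^ 2 + 6 * r * y w) / S w - r * Sq := by
      field_simp; linear_combination Sdyn
    rw [hθt, hyt, hSt]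
    push_cast
    field_simp
    ring
  have cu1 := hs.c1.continuous
  have cu2 := hs.c2.continuous
  have cx1 := hs.cx1.continuous
  have cx2 := hs.cx2.continuous
  have cx3 := hs.cx3.continuous
  set C : Set (ℝ × (ℝ × ℝ)) := {x | 0 ≤ x.1 ∧ x.1 ^ 3 + 2 * u1 x.2 * x.1 + u2 x.2 = 0 ∧
    2 * u1 x.2 + 3 / 4 * x.1 ^ 2 ≤ 2 * x.1 ^ 2 ∧ 0 ≤ 3 * x.1 ^ 2 + 2 * u1 x.2 ∧
    ε ≤ (3 * x.1 ^ 2 + 2 * u1 x.2) * (x1 x.2 * x.1 ^ 2 + x2 x.2 * x.1 + x3 x.2) ^ 2} with hC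
  have hCc : IsClosed C := by
    have k1 : IsClosed {x : ℝ × (ℝ × ℝ) | 0 ≤ x.1} := isClosed_le (by fun_prop) (by fun_prop)
    have k2 : IsClosed {x : ℝ × (ℝ × ℝ) | x.1 ^ 3 + 2 * u1 x.2 * x.1 + u2 x.2 = 0} :=
      isClosed_eq (by fun_prop) (by fun_prop)
    have k3 : IsClosed {x : ℝ × (ℝ × ℝ) | 2 * u1 x.2 + 3 / 4 * x.1 ^ 2 ≤ 2 * x.1 ^ 2} :=
      isClosed_le (by fun_prop) (by fun_prop)
    have k4 : IsClosed {x : ℝ × (ℝ × ℝ) | 0 ≤ 3 * x.1 ^ 2 + 2 * u1 x.2} :=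
      isClosed_le (by fun_prop) (by fun_prop)
    have k5 : IsClosed {x : ℝ × (ℝ × ℝ) | ε ≤ (3 * x.1 ^ 2 + 2 * u1 x.2) *
        (x1 x.2 * x.1 ^ 2 + x2 x.2 * x.1 + x3 x.2) ^ 2} :=
      isClosed_le (by fun_prop) (by fun_prop)
    exact k1.inter (k2.inter (k3.inter (k4.inter k5)))
  have hK := closed_proj hCc (bound_cont hs) (fun x hx => root_bound hx.2.1)
  set K : Set (ℝ × ℝ) := {w | ∃ r, (r, w) ∈ C} with hKdef
  have inK : ∀ w ∈ K, ∃ r, 0 < r ∧ r ^ 3 + 2 * u1 w * r + u2 w = 0 ∧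
      0 < 3 * r ^ 2 + 2 * u1 w := by
    rintro w ⟨r, h1, h2, h3, h4, h5⟩
    simp only at h1 h2 h3 h4 h5
    have hS1 : 0 < 3 * r ^ 2 + 2 * u1 w := by
      refine lt_of_le_of_ne h4 ?_
      intro h; rw [← h] at h5; simp at h5; linarith
    refine ⟨r, lt_of_le_of_ne h1 ?_, h2, hS1⟩
    rintro rfl
    simp at h3 hS1
    linarith
  set A : ℝ × ℝ → ℝ := fun w => if 0 < l w then g w else 0 with hA
  set B : ℝ × ℝ → ℝ := fun w => l w * A w with hB
  have pA : Per A := Per.comp2 pl pg fun l g => if 0 < l then g else 0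
  have offK : ∀ w, w ∉ K → A w = 0 := by
    intro w hw
    simp only [hA]
    split_ifs with h0
    · obtain ⟨⟨m1, m2⟩, m3⟩ := sel_spec (O := O1) (a := u1 w) (b := u2 w) h0.ne'
      simp only at m1 m2
      have hl2 : 0 < l w ^ 2 := by positivity
      by_cases hbw : b w ≤ 2 * l w ^ 2
      · have : W w - ε ≤ 0 := by
          by_contra hn
          push Not at hn
          exact hw ⟨l w, m1.le, m3, hbw, m2.le, by
            have : ε ≤ W w := by linarith
            exact this⟩
        simp only [hg, phi_zero this, mul_zero]
      · push Not at hbw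
        have : θ w = 0 := by
          apply Real.smoothTransition.zero_of_nonpos
          have : 2 < b w * (l w ^ 2)⁻¹ := by
            rw [← div_eq_mul_inv, lt_div_iff₀ hl2]; exact hbw
          linarith
        simp only [hg, this, zero_mul]
    · rfl
  have evA : ∀ w, (∀ᶠ v in 𝓝 w, 0 < l v) → A =ᶠ[𝓝 w] g := by
    intro w h
    filter_upwards [h] with v hv
    simp only [hA, if_pos hv]
  obtain ⟨-, cl, -, ev, lq, lt, gq, gt, k1, k2, k3⟩ := loc z p hp hr hS
  have fin := ext_div hK (A := A) (B := B)
    (by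
      intro w hw
      obtain ⟨r, r1, r2, r3⟩ := inK w hw
      obtain ⟨-, cl, cg, ev, -⟩ := loc w r r1 r2 r3
      exact cg.congr_of_eventuallyEq (evA w ev))
    (by
      intro w hw
      obtain ⟨r, r1, r2, r3⟩ := inK w hw
      obtain ⟨-, cl, cg, ev, -⟩ := loc w r r1 r2 r3
      exact (cl.of_le (le_trans (by norm_num) two_le_inf)).mul
        (cg.congr_of_eventuallyEq (evA w ev)))
    offK
    (by intro w hw; simp only [hB, offK w hw, mul_zero])
    pA (Per.comp2 pl pA fun a b => a * b)
    (by
      intro w hw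
      obtain ⟨r, r1, r2, r3⟩ := inK w hw
      obtain ⟨e, cl, cg, ev, lq, lt, gq, gt, k1, k2, k3⟩ := loc w r r1 r2 r3
      have k2' := k2.congr (evA w ev)
      refine ⟨_, _, _, _, k2', k1.mul k2', ?_⟩
      rw [(evA w ev).self_of_nhds]
      have : 0 ≤ gt + l w * gq + lq * g w := by
        rw [k3]
        have h1 : 0 ≤ θ w := Real.smoothTransition.nonneg _
        have h2 : 0 < S w := by simp only [hSdef, e]; exact r3
        positivity
      linarith)
    (k2.congr (evA z ev)) (k1.mul (k2.congr (evA z ev)))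
  rw [(evA z ev).self_of_nhds] at fin
  have fin2 : θ z * (2 * max (W z - ε) 0) * (6 * p * y z ^ 4 / S z) = 0 := by rw [← k3]; linarith
  have h1 : θ z = 1 := by
    apply Real.smoothTransition.one_of_one_le
    have hl2 : 0 < (l z ^ 2)⁻¹ := by rw [lz]; positivity
    have : b z ≤ 0 := by simp only [hbdef, lz]; exact hb
    nlinarith
  have h2 : 0 < S z := by simp only [hSdef, lz]; exact hS
  have h3 : y z ≠ 0 := by simp only [hy, lz]; exact hy0
  rw [h1, max_eq_left (by rw [hε]; linarith)] at fin2
  have h4 : 0 < W z - ε := by rw [hε]; linarith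
  have : 0 < 1 * (2 * (W z - ε)) * (6 * p * y z ^ 4 / S z) := by positivity
  linarith

lemma step3 (hs : Sol u1 u2 u3 x1 x2 x3)
    (H : ∀ w r, r ^ 3 + 2 * u1 w * r + u2 w = 0 → 3 * r ^ 2 + 2 * u1 w < 0 →
      x2 w = r * x1 w ∧ x3 w = (2 * u1 w + r ^ 2) * x1 w)
    {z : ℝ × ℝ} {p : ℝ}
    (hr : p ^ 3 + 2 * u1 z * p + u2 z = 0)
    (hS : 3 * p ^ 2 + 2 * u1 z < 0) : p * x1 z = 0 := by
  by_contra hy0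
  set l : ℝ × ℝ → ℝ := fun w => sel O3 (u1 w) (u2 w) with hl
  have pl : Per l := hs.p1.comp2 hs.p2 _
  set S : ℝ × ℝ → ℝ := fun w => 3 * l w ^ 2 + 2 * u1 w with hSdef
  have pS : Per S := Per.comp2 pl hs.p1 fun l u => 3 * l ^ 2 + 2 * u
  have lz : l z = p := (sel_loc hs good3 (z := z) hS hr).1
  obtain ⟨ε, hε⟩ : ∃ ε, ε = -S z / 2 := ⟨_, rfl⟩
  have hSz : S z < 0 := by simp only [hSdef, lz]; exact hS
  have hε0 : 0 < ε := by rw [hε]; linarith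
  set y : ℝ × ℝ → ℝ := fun w => l w * x1 w with hy
  have py : Per y := Per.comp2 pl hs.px1 fun a b => a * b
  set A : ℝ × ℝ → ℝ := fun w => -(y w ^ 3 * phi (-S w - ε)) with hA
  set B : ℝ × ℝ → ℝ := fun w => l w * A w with hB
  have pA : Per A := Per.comp2 py pS fun y S => -(y ^ 3 * phi (-S - ε))
  have loc : ∀ w r, r ^ 3 + 2 * u1 w * r + u2 w = 0 → 3 * r ^ 2 + 2 * u1 w < 0 →
      l w = r ∧ ContDiffAt ℝ ∞ l w ∧ ContDiffAt ℝ 1 A w ∧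
      ∃ a b c d, HP A w a b ∧ HP B w c d ∧
        c + b = 6 * phi (-S w - ε) * (y w ^ 4 / (-S w)) := by
    intro w r hrr hSr
    obtain ⟨e, cl, ev, hl'⟩ := sel_loc hs good3 (z := w) (p := r) hSr hrr
    change l w = r at e
    change ContDiffAt ℝ ∞ l w at cl
    change HP l w _ _ at hl'
    have hSw : S w = 3 * r ^ 2 + 2 * u1 w := by simp only [hSdef, e]
    have c1 := hs.c1.contDiffAt (x := w)
    have d1 := hs.cx1.contDiffAt (x := w)
    have cS : ContDiffAt ℝ ∞ S w := by rw [hSdef]; fun_prop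
    have cy : ContDiffAt ℝ ∞ y w := by rw [hy]; fun_prop
    have one_le : (1 : WithTop ℕ∞) ≤ ∞ := le_trans (by norm_num) two_le_inf
    have cA : ContDiffAt ℝ 1 A w :=
      (((cy.of_le one_le).pow 3).mul
        (phi_contDiff.contDiffAt.comp w ((cS.of_le one_le).neg.sub contDiffAt_const))).neg
    refine ⟨e, cl, cA, ?_⟩
    obtain ⟨k1, k2⟩ := H w r hrr hSr
    obtain ⟨s1, s2, s3, g1, g2, g3⟩ := hs.hx w
    obtain ⟨Q, hQ⟩ : ∃ Q, Q = -(2 * r * x1 w + x2 w) / (3 * r ^ 2 + 2 * u1 w) := ⟨_, rfl⟩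
    have hP : (2 * r * x2 w - 2 * u1 w * x1 w + x3 w) / (3 * r ^ 2 + 2 * u1 w) = - r * Q := by
      rw [hQ, k1, k2]; ring
    rw [← hQ, hP] at hl'
    rw [eq_div_iff hSr.ne, k1] at hQ
    have hx2 : HP x2 w _ _ := (hl'.mul g1).congr (by
      filter_upwards [ev] with v hv
      exact (H v _ hv.2 hv.1).1)
    have es := (g2.unique hx2).1
    rw [e] at es
    have hS' : HP S w _ _ := ((HP.const 3 w).mul (hl'.pow 2)).add ((HP.const 2 w).mul (hs.h1 w))
    obtain ⟨Sq, St, hS'', Sdyn⟩ : ∃ a c, HP S w a c ∧ c = - r * a := by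
      refine ⟨_, _, hS', ?_⟩
      rw [k1]; ring
    have hΦ : HP (fun w => phi (-S w - ε)) w _ _ :=
      HP.comp (phi_hasDeriv (-S w - ε)) (hS''.neg.sub (HP.const ε w))
    have hy' : HP y w _ _ := hl'.mul g1
    have hA' : HP A w _ _ := ((hy'.pow 3).mul hΦ).neg
    refine ⟨_, _, _, _, hA', hl'.mul hA', ?_⟩
    have yw : y w = r * x1 w := by simp only [hy, e]
    have Aw : A w = -(y w ^ 3 * phi (-S w - ε)) := rfl
    have hQ' : Q = -3 * r * x1 w / S w := by
      rw [hSw, eq_div_iff hSr.ne, hQ]; ring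
    have hS0 : S w ≠ 0 := by rw [hSw]; exact hSr.ne
    rw [Aw, yw, e, es, Sdyn, hQ']
    push_cast
    field_simp
    ring
  have cu1 := hs.c1.continuous
  have cu2 := hs.c2.continuous
  set C : Set (ℝ × (ℝ × ℝ)) := {x | x.1 ^ 3 + 2 * u1 x.2 * x.1 + u2 x.2 = 0 ∧
    3 * x.1 ^ 2 + 2 * u1 x.2 ≤ -ε} with hC
  have hCc : IsClosed C := by
    have k2 : IsClosed {x : ℝ × (ℝ × ℝ) | x.1 ^ 3 + 2 * u1 x.2 * x.1 + u2 x.2 = 0} :=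
      isClosed_eq (by fun_prop) (by fun_prop)
    have k3 : IsClosed {x : ℝ × (ℝ × ℝ) | 3 * x.1 ^ 2 + 2 * u1 x.2 ≤ -ε} :=
      isClosed_le (by fun_prop) (by fun_prop)
    exact k2.inter k3
  have hK := closed_proj hCc (bound_cont hs) (fun x hx => root_bound hx.1)
  set K : Set (ℝ × ℝ) := {w | ∃ r, (r, w) ∈ C} with hKdef
  have inK : ∀ w ∈ K, ∃ r, r ^ 3 + 2 * u1 w * r + u2 w = 0 ∧ 3 * r ^ 2 + 2 * u1 w < 0 := by
    rintro w ⟨r, h1, h2⟩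
    simp only at h1 h2
    exact ⟨r, h1, by linarith⟩
  have offK : ∀ w, w ∉ K → A w = 0 := by
    intro w hw
    by_cases h0 : l w = 0
    · simp [hA, hy, h0]
    · obtain ⟨m1, m3⟩ := sel_spec h0
      have : -S w - ε ≤ 0 := by
        by_contra hn
        push Not at hn
        exact hw ⟨l w, m3, by
          have : S w ≤ -ε := by linarith
          exact this⟩
      simp only [hA, phi_zero this, mul_zero, neg_zero]
  obtain ⟨-, -, -, a, b, c, d, k1, k2, k3⟩ := loc z p hr hS
  have fin := ext_div hK (A := A) (B := B)
    (by
      intro w hw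
      obtain ⟨r, r1, r2⟩ := inK w hw
      exact (loc w r r1 r2).2.2.1)
    (by
      intro w hw
      obtain ⟨r, r1, r2⟩ := inK w hw
      obtain ⟨-, cl, cg, -⟩ := loc w r r1 r2
      exact (cl.of_le (le_trans (by norm_num) two_le_inf)).mul cg)
    offK
    (by intro w hw; simp only [hB, offK w hw, mul_zero])
    pA (Per.comp2 pl pA fun a b => a * b)
    (by
      intro w hw
      obtain ⟨r, r1, r2⟩ := inK w hw
      obtain ⟨e, -, -, a, b, c, d, k1, k2, k3⟩ := loc w r r1 r2
      refine ⟨a, b, c, d, k1, k2, ?_⟩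
      rw [k3]
      have h1 : 0 ≤ phi (-S w - ε) := by unfold phi; positivity
      have h2 : 0 < -S w := by simp only [hSdef, e]; linarith
      positivity)
    k1 k2
  rw [k3] at fin
  have h1 : 0 < phi (-S z - ε) := by
    unfold phi
    have : 0 < -S z - ε := by rw [hε]; linarith
    rw [max_eq_left this.le]; positivity
  have h2 : 0 < -S z := by linarith
  have h3 : y z ≠ 0 := by simp only [hy, lz]; exact hy0
  have : 0 < 6 * phi (-S z - ε) * (y z ^ 4 / (-S z)) := by positivity
  linarith
end

section PartD

variable {u1 u2 u3 x1 x2 x3 : ℝ × ℝ → ℝ}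

lemma mkSol (c1 : ContDiff ℝ ∞ u1) (c2 : ContDiff ℝ ∞ u2) (c3 : ContDiff ℝ ∞ u3)
    (p1 : Per u1) (p2 : Per u2) (p3 : Per u3)
    (e1 : ∀ z, fderiv ℝ u1 z (0, 1) = - fderiv ℝ u2 z (1, 0))
    (e2 : ∀ z, fderiv ℝ u2 z (0, 1) = 2 * u1 z * fderiv ℝ u1 z (1, 0) - fderiv ℝ u3 z (1, 0))
    (e3 : ∀ z, fderiv ℝ u3 z (0, 1) = u2 z * fderiv ℝ u1 z (1, 0)) :
    Sol u1 u2 u3 (fun w => fderiv ℝ u1 w (1, 0)) (fun w => fderiv ℝ u2 w (1, 0))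
      (fun w => fderiv ℝ u3 w (1, 0)) := by
  have cd : ∀ {f : ℝ × ℝ → ℝ}, ContDiff ℝ ∞ f → ContDiff ℝ ∞ (fun w => fderiv ℝ f w (1, 0)) := by
    intro f hf
    exact (hf.fderiv_right (m := ∞) (by simp)).clm_apply contDiff_const
  have dd : ∀ {f : ℝ × ℝ → ℝ}, ContDiff ℝ ∞ f → ∀ z, DifferentiableAt ℝ f z := by
    intro f hf z
    exact (hf.differentiable (by simp)) z
  have h1 : ∀ z, HP u1 z (fderiv ℝ u1 z (1, 0)) (- fderiv ℝ u2 z (1, 0)) := fun z =>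
    (HP.of_diff (dd c1 z)).to rfl (e1 z)
  have h2 : ∀ z, HP u2 z (fderiv ℝ u2 z (1, 0))
    (2 * u1 z * fderiv ℝ u1 z (1, 0) - fderiv ℝ u3 z (1, 0)) := fun z =>
    (HP.of_diff (dd c2 z)).to rfl (e2 z)
  have h3 : ∀ z, HP u3 z (fderiv ℝ u3 z (1, 0)) (u2 z * fderiv ℝ u1 z (1, 0)) := fun z =>
    (HP.of_diff (dd c3 z)).to rfl (e3 z)
  refine ⟨c1, c2, c3, cd c1, cd c2, cd c3, p1, p2, p3, p1.fderiv _, p2.fderiv _, p3.fderiv _,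
    h1, h2, h3, ?_⟩
  intro z
  obtain ⟨a1, b1, d1, A1, B1⟩ := HP.second (z := z) (c1.contDiffAt.of_le two_le_inf)
  obtain ⟨a2, b2, d2, A2, B2⟩ := HP.second (z := z) (c2.contDiffAt.of_le two_le_inf)
  obtain ⟨a3, b3, d3, A3, B3⟩ := HP.second (z := z) (c3.contDiffAt.of_le two_le_inf)
  refine ⟨a1, a2, a3, A1.to rfl ?_, A2.to rfl ?_, A3.to rfl ?_⟩
  · simp only [e1] at B1
    exact (B1.unique A2.neg).1
  · simp only [e2] at B2
    rw [(B2.unique ((((HP.const 2 z).mul (h1 z)).mul A1).sub A3)).1]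
    ring
  · simp only [e3] at B3
    rw [(B3.unique ((h2 z).mul A1)).1]

lemma HP.refl {f : ℝ × ℝ → ℝ} {z : ℝ × ℝ} {a b : ℝ} (h : HP f (-z.1, z.2) a b) :
    HP (fun w => f (-w.1, w.2)) z (-a) b := by
  unfold HP at *
  have hg : HasFDerivAt (fun w : ℝ × ℝ => ((-w.1, w.2) : ℝ × ℝ))
      ((-ContinuousLinearMap.fst ℝ ℝ ℝ).prod (ContinuousLinearMap.snd ℝ ℝ ℝ)) z :=
    (hasFDerivAt_fst.neg).prodMk hasFDerivAt_snd
  refine (HasFDerivAt.comp z h hg).congr_fderiv ?_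
  ext <;> simp

lemma Sol.refl (hs : Sol u1 u2 u3 x1 x2 x3) :
    Sol (fun w => u1 (-w.1, w.2)) (fun w => - u2 (-w.1, w.2)) (fun w => u3 (-w.1, w.2))
      (fun w => - x1 (-w.1, w.2)) (fun w => x2 (-w.1, w.2)) (fun w => - x3 (-w.1, w.2)) := by
  have cr : ContDiff ℝ ∞ (fun w : ℝ × ℝ => ((-w.1, w.2) : ℝ × ℝ)) :=
    contDiff_fst.neg.prodMk contDiff_snd
  have pr : ∀ {f : ℝ × ℝ → ℝ}, Per f → Per (fun w => f (-w.1, w.2)) := by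
    intro f hf q t
    refine ⟨?_, (hf _ _).2⟩
    have := (hf (-(q + 1)) t).1
    simp only
    rw [← this]
    congr 2
    ring
  have pn : ∀ {f : ℝ × ℝ → ℝ}, Per f → Per (fun w => - f w) := by
    intro f hf q t
    simp only [(hf q t).1, (hf q t).2, and_self]
  refine ⟨hs.c1.comp cr, (hs.c2.comp cr).neg, hs.c3.comp cr, (hs.cx1.comp cr).neg, hs.cx2.comp cr,
    (hs.cx3.comp cr).neg, pr hs.p1, pn (pr hs.p2), pr hs.p3, pn (pr hs.px1), pr hs.px2,
    pn (pr hs.px3), ?_, ?_, ?_, ?_⟩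
  · intro z; exact (hs.h1 _).refl
  · intro z; exact (hs.h2 _).refl.neg.to (by ring) (by ring)
  · intro z; exact (hs.h3 _).refl.to (by ring) (by ring)
  · intro z
    obtain ⟨s1, s2, s3, A, B, C⟩ := hs.hx (-z.1, z.2)
    exact ⟨s1, -s2, s3, A.refl.neg.to (by ring) (by ring), B.refl.to (by ring) (by ring),
      C.refl.neg.to (by ring) (by ring)⟩

lemma Sol.mid (hs : Sol u1 u2 u3 x1 x2 x3) (w : ℝ × ℝ) (r : ℝ)
    (hr : r ^ 3 + 2 * u1 w * r + u2 w = 0) (hS : 3 * r ^ 2 + 2 * u1 w < 0) :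
    x2 w = r * x1 w ∧ x3 w = (2 * u1 w + r ^ 2) * x1 w := by
  obtain ⟨d, hd, hd2⟩ : ∃ d : ℝ, 0 < d ∧ d ^ 2 = -3 * r ^ 2 - 8 * u1 w :=
    ⟨√(-3 * r ^ 2 - 8 * u1 w), Real.sqrt_pos.2 (by nlinarith [sq_nonneg r]),
      Real.sq_sqrt (by nlinarith [sq_nonneg r])⟩
  have hdr : (3 * r) ^ 2 < d ^ 2 := by nlinarith
  have hdr' : |3 * r| < d := by
    have := sq_lt_sq.1 hdr
    rwa [abs_of_pos hd] at this
  obtain ⟨g1, g2⟩ := abs_lt.1 hdr'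
  have hu : u1 w = (-3 * r ^ 2 - d ^ 2) / 8 := by linarith
  have hu2 : u2 w = - r ^ 3 - 2 * u1 w * r := by linarith
  have F1 : x1 w * ((-r + d) / 2) ^ 2 + x2 w * ((-r + d) / 2) + x3 w = 0 := by
    apply step2 hs
    · rcases le_total 0 r with h | h <;> linarith
    · rw [hu2, hu]; ring
    · rw [hu]; nlinarith [sq_nonneg (d + 3 * r)]
    · rw [hu]; nlinarith [mul_pos hd (by linarith : 0 < d - 3 * r)]
  have F2 := step2 hs.refl (z := (-w.1, w.2)) (p := (r + d) / 2)
    (by rcases le_total 0 r with h | h <;> linarith)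
    (by simp only [neg_neg, Prod.mk.eta]; rw [hu2, hu]; ring)
    (by simp only [neg_neg, Prod.mk.eta]; rw [hu]; nlinarith [sq_nonneg (d - 3 * r)])
    (by simp only [neg_neg, Prod.mk.eta]; rw [hu]
        nlinarith [mul_pos hd (by linarith : 0 < d + 3 * r)])
  simp only [neg_neg, Prod.mk.eta] at F2
  have G : d * (x2 w - r * x1 w) = 0 := by linear_combination F1 + F2
  have G1 : x2 w - r * x1 w = 0 := (mul_eq_zero.1 G).resolve_left hd.ne'
  refine ⟨by linarith, ?_⟩
  rw [hu]
  linear_combination F1 - (-r + d) / 2 * G1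

lemma Sol.key (hs : Sol u1 u2 u3 x1 x2 x3) (w : ℝ × ℝ) (r : ℝ)
    (hr : r ^ 3 + 2 * u1 w * r + u2 w = 0) (hS : 3 * r ^ 2 + 2 * u1 w < 0) :
    x2 w = r * x1 w ∧ x3 w = (2 * u1 w + r ^ 2) * x1 w ∧ r * x1 w = 0 :=
  ⟨(hs.mid w r hr hS).1, (hs.mid w r hr hS).2, step3 hs hs.mid hr hS⟩

lemma mid_of_three {a b c u v : ℝ} (hab : a < b) (hbc : b < c)
    (ha : a ^ 3 + 2 * u * a + v = 0) (hb : b ^ 3 + 2 * u * b + v = 0)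
    (hc : c ^ 3 + 2 * u * c + v = 0) : 3 * b ^ 2 + 2 * u < 0 := by
  have h1 : (b - a) * (a ^ 2 + a * b + b ^ 2 + 2 * u) = 0 := by linear_combination hb - ha
  have h2 : (c - b) * (c ^ 2 + c * b + b ^ 2 + 2 * u) = 0 := by linear_combination hc - hb
  have h1 := (mul_eq_zero.1 h1).resolve_left (by linarith)
  have h2 := (mul_eq_zero.1 h2).resolve_left (by linarith)
  have h3 : (c - a) * (a + b + c) = 0 := by linear_combination h2 - h1
  have h3 := (mul_eq_zero.1 h3).resolve_left (by linarith)
  have : c = -a - b := by linarith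
  subst this
  nlinarith [mul_pos (sub_pos.2 hab) (sub_pos.2 hbc)]

lemma HP.zero_fderiv {f : ℝ × ℝ → ℝ} {z : ℝ × ℝ} (h : HP f z 0 0) : fderiv ℝ f z = 0 := by
  rw [HasFDerivAt.fderiv h]; simp

/-- local constancy from vanishing gradient near a point -/
lemma loc_const {f : ℝ × ℝ → ℝ} {O : Set (ℝ × ℝ)} (hO : IsOpen O) (h : ∀ z ∈ O, HP f z 0 0)
    {z : ℝ × ℝ} (hz : z ∈ O) : ∀ᶠ w in 𝓝 z, f w = f z := by
  obtain ⟨ε, hε, hb⟩ := Metric.isOpen_iff.1 hO z hz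
  filter_upwards [Metric.ball_mem_nhds z hε] with w hw
  refine (convex_ball z ε).is_const_of_fderivWithin_eq_zero (𝕜 := ℝ)
    (fun y hy => (h y (hb hy)).differentiableAt.differentiableWithinAt) ?_ hw
    (Metric.mem_ball_self hε)
  intro y hy
  rw [fderivWithin_of_isOpen Metric.isOpen_ball hy]
  exact (h y (hb hy)).zero_fderiv

/-- the main argument -/
lemma final (hs : Sol u1 u2 u3 x1 x2 x3) (Ωh : Set (ℝ × ℝ)) (hO : IsOpen Ωh)
    (hΩh : ∀ z : ℝ × ℝ, z ∈ Ωh ↔ ∃ a b c : ℝ, a < b ∧ b < c ∧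
      a ^ 3 + 2 * u1 z * a + u2 z = 0 ∧ b ^ 3 + 2 * u1 z * b + u2 z = 0 ∧
      c ^ 3 + 2 * u1 z * c + u2 z = 0) :
    (∃ c₁ c₂ c₃ : ℝ, ∀ z, u1 z = c₁ ∧ u2 z = c₂ ∧ u3 z = c₃) ∨
    ((∀ q t t' : ℝ, (q, t) ∈ Ωh → (q, t') ∈ Ωh) ∧
     (∀ z ∈ Ωh, u2 z = 0 ∧ x2 z = 0) ∧
     (∀ z ∈ Ωh, ∃ c : ℝ, ∀ w ∈ connectedComponentIn Ωh z, u3 w = u1 w ^ 2 + c)) := by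
  have key : ∀ z ∈ Ωh, ∃ r, r ^ 3 + 2 * u1 z * r + u2 z = 0 ∧ 3 * r ^ 2 + 2 * u1 z < 0 ∧
      x2 z = r * x1 z ∧ x3 z = (2 * u1 z + r ^ 2) * x1 z ∧ r * x1 z = 0 := by
    intro z hz
    obtain ⟨a, b, c, hab, hbc, ha, hb, hc⟩ := (hΩh z).1 hz
    have hS := mid_of_three hab hbc ha hb hc
    exact ⟨b, hb, hS, hs.key z b hb hS⟩
  have k2 : Continuous u2 := hs.c2.continuous
  have k1 : Continuous u1 := hs.c1.continuous
  have k3 : Continuous u3 := hs.c3.continuous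
  by_cases hz0 : ∃ z ∈ Ωh, u2 z ≠ 0
  · left
    obtain ⟨z, hz, h2⟩ := hz0
    set V : Set (ℝ × ℝ) := Ωh ∩ {w | u2 w ≠ 0} with hV
    have oV : IsOpen V := hO.inter (isOpen_ne_fun k2 continuous_const)
    have grad : ∀ w ∈ V, x1 w = 0 ∧ x2 w = 0 ∧ x3 w = 0 := by
      rintro w ⟨hw, hw2⟩
      obtain ⟨r, hr, -, e2, e3, e⟩ := key w hw
      have hr0 : r ≠ 0 := by
        rintro rfl
        apply hw2
        simpa using hr
      have e1 : x1 w = 0 := (mul_eq_zero.1 e).resolve_left hr0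
      exact ⟨e1, by rw [e2, e1]; ring, by rw [e3, e1]; ring⟩
    set L : Set (ℝ × ℝ) := {w | u1 w = u1 z ∧ u2 w = u2 z ∧ u3 w = u3 z} with hL
    have LV : L ⊆ V := by
      rintro w ⟨w1, w2, w3⟩
      refine ⟨?_, ?_⟩
      · rw [hΩh, w1, w2]; exact (hΩh z).1 hz
      · change u2 w ≠ 0
        rwa [w2]
    have cL : IsClosed L := (isClosed_eq k1 continuous_const).inter
      ((isClosed_eq k2 continuous_const).inter (isClosed_eq k3 continuous_const))
    have oL : IsOpen L := by
      rw [isOpen_iff_mem_nhds]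
      intro w hw
      have hwV := LV hw
      have a1 := loc_const (f := u1) oV (fun y hy => (hs.h1 y).to (grad y hy).1
        (by rw [(grad y hy).2.1, neg_zero])) hwV
      have a2 := loc_const (f := u2) oV (fun y hy => (hs.h2 y).to (grad y hy).2.1
        (by rw [(grad y hy).1, (grad y hy).2.2]; ring)) hwV
      have a3 := loc_const (f := u3) oV (fun y hy => (hs.h3 y).to (grad y hy).2.2
        (by rw [(grad y hy).1]; ring)) hwV
      filter_upwards [a1, a2, a3] with y y1 y2 y3
      exact ⟨y1.trans hw.1, y2.trans hw.2.1, y3.trans hw.2.2⟩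
    have : L = univ := IsClopen.eq_univ ⟨cL, oL⟩ ⟨z, rfl, rfl, rfl⟩
    refine ⟨u1 z, u2 z, u3 z, fun w => ?_⟩
    have hw : w ∈ L := this ▸ mem_univ w
    exact hw
  · right
    push Not at hz0
    have hx : ∀ z ∈ Ωh, x2 z = 0 ∧ x3 z = 2 * u1 z * x1 z := by
      intro z hz
      have e : u2 =ᶠ[𝓝 z] fun _ => 0 := by
        filter_upwards [hO.mem_nhds hz] with w hw using hz0 w hw
      obtain ⟨g1, g2⟩ := (hs.h2 z).unique ((HP.const 0 z).congr e)
      exact ⟨g1, by linarith⟩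
    refine ⟨?_, fun z hz => ⟨hz0 z hz, (hx z hz).1⟩, ?_⟩
    · intro q t t' h
      set L : Set ℝ := {s | u1 (q, s) = u1 (q, t) ∧ u2 (q, s) = u2 (q, t)} with hL
      have hin : ∀ s ∈ L, (q, s) ∈ Ωh := by
        rintro s ⟨h1, h2⟩
        rw [hΩh, h1, h2]; exact (hΩh _).1 h
      have cL : IsClosed L :=
        (isClosed_eq (k1.comp (by fun_prop)) continuous_const).inter
          (isClosed_eq (k2.comp (by fun_prop)) continuous_const)
      have oL : IsOpen L := by
        rw [Metric.isOpen_iff]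
        intro s hsL
        have hsO := hin s hsL
        have cq : Continuous (fun y : ℝ => ((q, y) : ℝ × ℝ)) := by fun_prop
        obtain ⟨ε, hε, hb⟩ := Metric.isOpen_iff.1 (hO.preimage cq) s hsO
        refine ⟨ε, hε, fun y hy => ?_⟩
        have hyO := hb hy
        refine ⟨?_, (hz0 _ hyO).trans (hz0 _ h).symm⟩
        refine Eq.trans ?_ hsL.1
        have hd : ∀ y ∈ Metric.ball s ε, HasDerivWithinAt (fun y => u1 (q, y)) 0
            (Metric.ball s ε) y := by
          intro y hy
          have := HasFDerivAt.comp_hasDerivAt y (hs.h1 (q, y))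
            ((hasDerivAt_const y q).prodMk (hasDerivAt_id y))
          simpa [(hx _ (hb hy)).1, Function.comp_def] using this.hasDerivWithinAt
        refine (convex_ball s ε).is_const_of_fderivWithin_eq_zero (𝕜 := ℝ)
          (f := fun y => u1 (q, y)) (fun y hy => (hd y hy).differentiableWithinAt) ?_ hy
          (Metric.mem_ball_self hε)
        intro y hy
        have := (hd y hy).hasFDerivWithinAt.fderivWithin
          (Metric.isOpen_ball.uniqueDiffWithinAt hy)
        rw [this]
        ext; simp
      have : L = univ := IsClopen.eq_univ ⟨cL, oL⟩ ⟨t, rfl, rfl⟩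
      exact hin t' (this ▸ mem_univ t')
    · intro z hz
      have oC : IsOpen (connectedComponentIn Ωh z) := hO.connectedComponentIn
      have sub := connectedComponentIn_subset Ωh z
      have hd : ∀ w ∈ connectedComponentIn Ωh z, HP (fun w => u3 w - u1 w ^ 2) w 0 0 := by
        intro w hw
        obtain ⟨y2, y3⟩ := hx w (sub hw)
        refine ((hs.h3 w).sub ((hs.h1 w).pow 2)).to ?_ ?_
        · rw [y3]; push_cast; ring
        · rw [y2, hz0 w (sub hw)]; ring
      obtain ⟨c, hc⟩ := oC.exists_is_const_of_fderiv_eq_zero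
        (𝕜 := ℝ) (f := fun w => u3 w - u1 w ^ 2) isPreconnected_connectedComponentIn
        (fun w hw => (hd w hw).differentiableAt.differentiableWithinAt)
        (fun w hw => (hd w hw).zero_fderiv)
      exact ⟨c, fun w hw => by have := hc w hw; linarith⟩

lemma deriv_q (u : ℝ → ℝ → ℝ) (h : ContDiff ℝ ∞ (fun z : ℝ × ℝ => u z.1 z.2)) (q t : ℝ) :
    deriv (fun x => u x t) q = fderiv ℝ (fun z : ℝ × ℝ => u z.1 z.2) (q, t) (1, 0) := by
  have hd := (h.differentiable (by simp) (q, t)).hasFDerivAt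
  have := HasFDerivAt.comp_hasDerivAt (f := fun x : ℝ => (x, t)) q hd
    ((hasDerivAt_id q).prodMk (hasDerivAt_const q t))
  exact this.deriv

lemma deriv_t (u : ℝ → ℝ → ℝ) (h : ContDiff ℝ ∞ (fun z : ℝ × ℝ => u z.1 z.2)) (q t : ℝ) :
    deriv (fun s => u q s) t = fderiv ℝ (fun z : ℝ × ℝ => u z.1 z.2) (q, t) (0, 1) := by
  have hd := (h.differentiable (by simp) (q, t)).hasFDerivAt
  have := HasFDerivAt.comp_hasDerivAt (f := fun s : ℝ => (q, s)) t hd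
    ((hasDerivAt_const t q).prodMk (hasDerivAt_id t))
  exact this.deriv

end PartD
end BenneyAux

end BenneySec

/-- description of a smooth periodic solution of the n = 3 Benney
reduction on the strictly hyperbolic region `Ω_h`: either the solution is
constant, or `Ω_h` is a union of strips parallel to the `t`-axis, on it
`u₂ = 0`, `∂_t u₁ = ∂_t u₃ = 0`, and on each connected component
`u₃ = u₁² + c`, so that `F = (p²/2 + u₁(q))² + c`. -/
theorem hyperbolic_region_description
    (u₁ u₂ u₃ : ℝ → ℝ → ℝ)
    (hu₁ : ContDiff ℝ (⊤ : ℕ∞) (fun z : ℝ × ℝ => u₁ z.1 z.2))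
    (hu₂ : ContDiff ℝ (⊤ : ℕ∞) (fun z : ℝ × ℝ => u₂ z.1 z.2))
    (hu₃ : ContDiff ℝ (⊤ : ℕ∞) (fun z : ℝ × ℝ => u₃ z.1 z.2))
    (hq₁ : ∀ t, Function.Periodic (fun q => u₁ q t) 1)
    (hq₂ : ∀ t, Function.Periodic (fun q => u₂ q t) 1)
    (hq₃ : ∀ t, Function.Periodic (fun q => u₃ q t) 1)
    (ht₁ : ∀ q, Function.Periodic (fun t => u₁ q t) 1)
    (ht₂ : ∀ q, Function.Periodic (fun t => u₂ q t) 1)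
    (ht₃ : ∀ q, Function.Periodic (fun t => u₃ q t) 1)
    (hsys₁ : ∀ q t, deriv (fun s => u₁ q s) t + deriv (fun x => u₂ x t) q = 0)
    (hsys₂ : ∀ q t, deriv (fun s => u₂ q s) t + deriv (fun x => u₃ x t) q
        - 2 * u₁ q t * deriv (fun x => u₁ x t) q = 0)
    (hsys₃ : ∀ q t, deriv (fun s => u₃ q s) t - u₂ q t * deriv (fun x => u₁ x t) q = 0)
    (Ωh : Set (ℝ × ℝ)) (hΩh_open : IsOpen Ωh)
    (hΩh : ∀ z : ℝ × ℝ, z ∈ Ωh ↔ ∃ a b c : ℝ, a < b ∧ b < c ∧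
      a ^ 3 + 2 * u₁ z.1 z.2 * a + u₂ z.1 z.2 = 0 ∧
      b ^ 3 + 2 * u₁ z.1 z.2 * b + u₂ z.1 z.2 = 0 ∧
      c ^ 3 + 2 * u₁ z.1 z.2 * c + u₂ z.1 z.2 = 0) :
    (∃ c₁ c₂ c₃ : ℝ, ∀ q t, u₁ q t = c₁ ∧ u₂ q t = c₂ ∧ u₃ q t = c₃) ∨
    ((∀ q t t' : ℝ, (q, t) ∈ Ωh → (q, t') ∈ Ωh) ∧
     (∀ z ∈ Ωh, u₂ z.1 z.2 = 0 ∧ deriv (fun s => u₁ z.1 s) z.2 = 0 ∧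
        deriv (fun s => u₃ z.1 s) z.2 = 0) ∧
     (∀ z ∈ Ωh, ∃ c : ℝ, ∀ w ∈ connectedComponentIn Ωh z,
        u₃ w.1 w.2 = u₁ w.1 w.2 ^ 2 + c ∧
        ∀ p : ℝ, p ^ 4 / 4 + u₁ w.1 w.2 * p ^ 2 + u₂ w.1 w.2 * p + u₃ w.1 w.2
          = (p ^ 2 / 2 + u₁ w.1 w.2) ^ 2 + c)) := by
  have P : ∀ {u : ℝ → ℝ → ℝ}, (∀ t, Function.Periodic (fun q => u q t) 1) →
      (∀ q, Function.Periodic (fun t => u q t) 1) →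
      BenneyAux.Per (fun z : ℝ × ℝ => u z.1 z.2) := fun hq ht q t => ⟨hq t q, ht q t⟩
  have dq₁ := BenneyAux.deriv_q u₁ hu₁
  have dq₂ := BenneyAux.deriv_q u₂ hu₂
  have dq₃ := BenneyAux.deriv_q u₃ hu₃
  have dt₁ := BenneyAux.deriv_t u₁ hu₁
  have dt₂ := BenneyAux.deriv_t u₂ hu₂
  have dt₃ := BenneyAux.deriv_t u₃ hu₃
  have hs := BenneyAux.mkSol hu₁ hu₂ hu₃ (P hq₁ ht₁) (P hq₂ ht₂) (P hq₃ ht₃)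
    (by rintro ⟨q, t⟩
        have := hsys₁ q t
        rw [dt₁, dq₂] at this
        linarith)
    (by rintro ⟨q, t⟩
        have := hsys₂ q t
        rw [dt₂, dq₃, dq₁] at this
        simp only
        linarith)
    (by rintro ⟨q, t⟩
        have := hsys₃ q t
        rw [dt₃, dq₁] at this
        simp only
        linarith)
  rcases BenneyAux.final hs Ωh hΩh_open hΩh with ⟨c₁, c₂, c₃, h⟩ | ⟨h1, h2, h3⟩
  · exact Or.inl ⟨c₁, c₂, c₃, fun q t => h (q, t)⟩
  · refine Or.inr ⟨h1, ?_, ?_⟩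
    · rintro ⟨q, t⟩ hz
      obtain ⟨e1, e2⟩ := h2 _ hz
      refine ⟨e1, ?_, ?_⟩
      · have := hsys₁ q t
        rw [dq₂] at this
        simp only
        linarith
      · have := hsys₃ q t
        rw [show u₂ q t = 0 from e1] at this
        simp only
        linarith
    · intro z hz
      obtain ⟨c, hc⟩ := h3 z hz
      refine ⟨c, fun w hw => ⟨hc w hw, fun p => ?_⟩⟩
      have e2 := (h2 w (connectedComponentIn_subset Ωh z hw)).1
      have e3 := hc w hw
      rw [e2, e3]
      ring
end

section
/- Let u₁, u₂, u₃ be a smooth periodic solution of the quasi-linear system. Then either (u₁, u₂, u₃) is constant on all of ℝ², or the following hold: the elliptic region Ω_e is a union of strips parallel to the t-axis (i.e., (q,t) ∈ Ω_e iff (q,t') ∈ Ω_e for all t, t' ∈ ℝ); on Ω_e one has u₂ = 0, α = 0, β² = 2u₁, ∂_t u₁ = 0; and on each connected component of Ω_e there is a constant c ∈ ℝ with u₃ = u₁² + c, so that on that component F(p,q,t) = (p²/2 + u₁(q))² + c is the square of the energy up to an additive constant. -/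
/-- double periodicity -/
def BPer (f : ℝ × ℝ → ℝ) : Prop :=
  (∀ z, f (z + (1, 0)) = f z) ∧ (∀ z, f (z + (0, 1)) = f z)

lemma bper_fderiv {f : ℝ × ℝ → ℝ} (h : BPer f) (v : ℝ × ℝ) :
    BPer (fun z => fderiv ℝ f z v) := by
  constructor
  · intro z
    have : (fun w => f (w + (1, 0))) = f := funext h.1
    show fderiv ℝ f (z + (1, 0)) v = _
    rw [← fderiv_comp_add_right, this]
  · intro z
    have : (fun w => f (w + (0, 1))) = f := funext h.2
    show fderiv ℝ f (z + (0, 1)) v = _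
    rw [← fderiv_comp_add_right, this]

lemma bper_exists_max {f : ℝ × ℝ → ℝ} (h : BPer f) (hc : Continuous f) :
    ∃ z, ∀ w, f w ≤ f z := by
  have hK : IsCompact (Set.Icc (0 : ℝ) 1 ×ˢ Set.Icc (0 : ℝ) 1) := isCompact_Icc.prod isCompact_Icc
  obtain ⟨z, _, hz⟩ := hK.exists_isMaxOn ⟨(0, 0), by simp⟩ hc.continuousOn
  refine ⟨z, fun w => ?_⟩
  have h1 : ∀ t, Function.Periodic (fun q => f (q, t)) 1 := fun t q => by
    have := h.1 (q, t); simpa using this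
  have h2 : ∀ q, Function.Periodic (fun t => f (q, t)) 1 := fun q t => by
    have := h.2 (q, t); simpa using this
  have e1 : f w = f (Int.fract w.1, Int.fract w.2) := by
    have a1 := (h1 w.2).sub_zsmul_eq (x := w.1) ⌊w.1⌋
    have a2 := (h2 (Int.fract w.1)).sub_zsmul_eq (x := w.2) ⌊w.2⌋
    simp only [zsmul_eq_mul, mul_one, Int.self_sub_floor] at a1 a2
    rw [a2, a1]
  rw [e1]
  apply hz
  exact ⟨⟨Int.fract_nonneg _, (Int.fract_lt_one _).le⟩, ⟨Int.fract_nonneg _, (Int.fract_lt_one _).le⟩⟩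

open MeasureTheory Set in
lemma bper_div_zero {f g : ℝ × ℝ → ℝ} (hf : ContDiff ℝ 1 f) (hg : ContDiff ℝ 1 g)
    (pf : BPer f) (pg : BPer g)
    (hn : ∀ z, 0 ≤ fderiv ℝ f z (1, 0) + fderiv ℝ g z (0, 1)) (z : ℝ × ℝ) :
    fderiv ℝ f z (1, 0) + fderiv ℝ g z (0, 1) = 0 := by
  have cf : Continuous (fun z => fderiv ℝ f z (1, 0)) :=
    (hf.continuous_fderiv one_ne_zero).clm_apply continuous_const
  have cg : Continuous (fun z => fderiv ℝ g z (0, 1)) :=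
    (hg.continuous_fderiv one_ne_zero).clm_apply continuous_const
  have cD : Continuous (fun z => fderiv ℝ f z (1, 0) + fderiv ℝ g z (0, 1)) := cf.add cg
  set a : ℝ × ℝ := (z.1 - 1/2, z.2 - 1/2) with ha
  set b : ℝ × ℝ := (z.1 - 1/2 + 1, z.2 - 1/2 + 1) with hb
  have hle : a ≤ b := by constructor <;> simp [ha, hb]
  have hI : IntegrableOn (fun z => fderiv ℝ f z (1, 0) + fderiv ℝ g z (0, 1)) (Icc a b) :=
    cD.continuousOn.integrableOn_compact isCompact_Icc
  have key := integral_divergence_prod_Icc_of_hasFDerivAt_off_countable_of_le f g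
    (fderiv ℝ f) (fderiv ℝ g) a b hle ∅ countable_empty hf.continuous.continuousOn
    hg.continuous.continuousOn
    (fun x _ => (hf.differentiable one_ne_zero x).hasFDerivAt)
    (fun x _ => (hg.differentiable one_ne_zero x).hasFDerivAt) hI
  have e1 : ∀ x, g (x, b.2) = g (x, a.2) := fun x => by
    have := pg.2 (x, a.2); simpa [ha, hb] using this
  have e2 : ∀ y, f (b.1, y) = f (a.1, y) := fun y => by
    have := pf.1 (a.1, y); simpa [ha, hb] using this
  simp only [e1, e2] at key
  rw [sub_self, zero_add, sub_self, setIntegral_eq_zero_iff_of_nonneg_ae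
    (Filter.Eventually.of_forall hn) hI] at key
  have sub : Ioo a.1 b.1 ×ˢ Ioo a.2 b.2 ⊆ Icc a b := by
    rintro x ⟨⟨h1, h2⟩, ⟨h3, h4⟩⟩
    exact ⟨⟨h1.le, h3.le⟩, ⟨h2.le, h4.le⟩⟩
  have key2 := ae_restrict_of_ae_restrict_of_subset sub key
  have := Measure.eqOn_open_of_ae_eq key2 (isOpen_Ioo.prod isOpen_Ioo) cD.continuousOn
    continuousOn_const
  refine this (x := z) ⟨⟨?_, ?_⟩, ⟨?_, ?_⟩⟩ <;> simp [ha, hb] <;> linarith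

lemma exists_cutoff (ε : ℝ) : ∃ G : ℝ → ℝ, ContDiff ℝ 2 G ∧ (∀ s, s ^ 2 ≤ ε → G s = 0) ∧
    (∀ s, 0 ≤ deriv G s) ∧ (∀ s, ε < s ^ 2 → s ≠ 0 → G s ≠ 0 ∧ 0 < deriv G s) := by
  have hT : ContDiff ℝ 2 Real.smoothTransition := Real.smoothTransition.contDiff (n := 2)
  have hd : ∀ s, deriv (fun s => s * Real.smoothTransition (s ^ 2 - ε)) s
      = Real.smoothTransition (s ^ 2 - ε)
        + 2 * s ^ 2 * deriv Real.smoothTransition (s ^ 2 - ε) := by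
    intro s
    have h1 : HasDerivAt (fun s : ℝ => s ^ 2 - ε) (2 * s) s := by
      simpa using (hasDerivAt_pow 2 s).sub_const ε
    have h2 := (hT.differentiable two_ne_zero (s ^ 2 - ε)).hasDerivAt.comp s h1
    have h3 := ((hasDerivAt_id s).mul h2).deriv
    refine Eq.trans h3 ?_
    simp
    ring
  have hT' : ∀ s, 0 ≤ deriv Real.smoothTransition s := fun s =>
    Real.smoothTransition.monotone.deriv_nonneg
  refine ⟨fun s => s * Real.smoothTransition (s ^ 2 - ε), ?_, ?_, ?_, ?_⟩
  · exact contDiff_id.mul (hT.comp ((contDiff_id.pow 2).sub contDiff_const))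
  · intro s hs
    simp [Real.smoothTransition.zero_of_nonpos (sub_nonpos.2 hs)]
  · intro s
    rw [hd]
    have := Real.smoothTransition.nonneg (s ^ 2 - ε)
    have := hT' (s ^ 2 - ε)
    positivity
  · intro s hs h0
    have := Real.smoothTransition.pos_of_pos (sub_pos.2 hs)
    refine ⟨by positivity, ?_⟩
    rw [hd]
    have := hT' (s ^ 2 - ε)
    positivity

lemma fderiv2_comm {f : ℝ × ℝ → ℝ} {z : ℝ × ℝ} (hf : ContDiffAt ℝ 2 f z) (v w : ℝ × ℝ) :
    fderiv ℝ (fun x => fderiv ℝ f x v) z w = fderiv ℝ (fun x => fderiv ℝ f x w) z v := by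
  have hd : DifferentiableAt ℝ (fderiv ℝ f) z :=
    (hf.fderiv_right (m := 1) (by norm_num)).differentiableAt one_ne_zero
  rw [fderiv_clm_apply hd (differentiableAt_const _), fderiv_clm_apply hd (differentiableAt_const _)]
  simpa using (hf.isSymmSndFDerivAt (by simp)) w v

/-- periodic Burgers solutions are constant -/
lemma burgers_const {f : ℝ × ℝ → ℝ} (hf : ContDiff ℝ 2 f) (pf : BPer f)
    (h : ∀ z, fderiv ℝ f z (0, 1) = 2 * f z * fderiv ℝ f z (1, 0)) (z : ℝ × ℝ) :
    fderiv ℝ f z = 0 := by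
  set w : ℝ × ℝ → ℝ := fun z => fderiv ℝ f z (1, 0) with hw
  have hwc : ContDiff ℝ 1 w := (hf.fderiv_right (m := 1) (by norm_num)).clm_apply contDiff_const
  have pw : BPer w := bper_fderiv pf _
  have hfd := hf.differentiable two_ne_zero
  have hwd := hwc.differentiable one_ne_zero
  have hcr : ∀ z, fderiv ℝ w z = 0 → w z = 0 := by
    intro z hz
    have h1 := fderiv2_comm (hf.contDiffAt (x := z)) (1, 0) (0, 1)
    have h2 : (fun x => fderiv ℝ f x (0, 1)) = fun x => 2 * f x * w x := funext h
    have h3 : HasFDerivAt (fun x => 2 * f x * w x)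
        ((2 * f z) • fderiv ℝ w z + w z • ((2 : ℝ) • fderiv ℝ f z)) z :=
      ((hfd z).hasFDerivAt.const_mul 2).mul (hwd z).hasFDerivAt
    rw [h2, h3.fderiv] at h1
    change fderiv ℝ w z (0, 1) = _ at h1
    rw [hz] at h1
    simp at h1
    simpa [hw] using h1
  obtain ⟨z1, h1⟩ := bper_exists_max pw hwc.continuous
  obtain ⟨z2, h2⟩ := bper_exists_max (f := fun z => - w z)
    ⟨fun z => by simp [pw.1], fun z => by simp [pw.2]⟩ hwc.continuous.neg
  have e1 := hcr z1 (IsLocalMax.fderiv_eq_zero (Filter.Eventually.of_forall h1))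
  have e2 := hcr z2 (IsLocalMin.fderiv_eq_zero (Filter.Eventually.of_forall
    (fun x => by have := h2 x; linarith)))
  have e0 : fderiv ℝ f z (1, 0) = 0 := by
    have a1 := h1 z
    have a2 := h2 z
    simp only [hw] at *
    linarith
  have e3 : fderiv ℝ f z (0, 1) = 0 := by rw [h, e0, mul_zero]
  ext <;> simp [e0, e3]

section core
variable {A B U1 U2 U3 : ℝ × ℝ → ℝ} {Ω : Set (ℝ × ℝ)}

lemma core_derivs (hO : IsOpen Ω)
    (h3 : Differentiable ℝ U3)
    (hA : DifferentiableOn ℝ A Ω) (hB : DifferentiableOn ℝ B Ω)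
    (r1 : ∀ z ∈ Ω, 2 * U1 z = B z ^ 2 - 3 * A z ^ 2)
    (r2 : ∀ z ∈ Ω, U2 z = 2 * A z * (A z ^ 2 + B z ^ 2)) (z : ℝ × ℝ) (hz : z ∈ Ω) (v : ℝ × ℝ) :
    fderiv ℝ (fun z => 2 * A z * B z ^ 3) z v
      = 2 * B z ^ 3 * fderiv ℝ A z v + 6 * A z * B z ^ 2 * fderiv ℝ B z v ∧
    fderiv ℝ U1 z v = B z * fderiv ℝ B z v - 3 * A z * fderiv ℝ A z v ∧
    fderiv ℝ U2 z v = (6 * A z ^ 2 + 2 * B z ^ 2) * fderiv ℝ A z v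
      + 4 * A z * B z * fderiv ℝ B z v ∧
    fderiv ℝ (fun z => U3 z + (3 * A z ^ 4 + 10 * A z ^ 2 * B z ^ 2 - B z ^ 4) / 4) z v
      = fderiv ℝ U3 z v + (3 * A z ^ 3 + 5 * A z * B z ^ 2) * fderiv ℝ A z v
        + (5 * A z ^ 2 * B z - B z ^ 3) * fderiv ℝ B z v := by
  have n := hO.mem_nhds hz
  have a := ((hA z hz).differentiableAt n).hasFDerivAt
  have b := ((hB z hz).differentiableAt n).hasFDerivAt
  have c := (h3 z).hasFDerivAt
  have e1 : U1 =ᶠ[nhds z] fun z => (B z ^ 2 - 3 * A z ^ 2) / 2 := by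
    filter_upwards [n] with w hw
    have := r1 w hw
    linarith
  have e2 : U2 =ᶠ[nhds z] fun z => 2 * A z * (A z ^ 2 + B z ^ 2) := by
    filter_upwards [n] with w hw using r2 w hw
  refine ⟨?_, ?_, ?_, ?_⟩
  · rw [((a.const_mul 2).fun_mul (b.pow 3)).fderiv]
    simp
    ring
  · rw [e1.fderiv_eq]
    simp only [div_eq_mul_inv]
    rw [(((b.pow 2).fun_sub ((a.pow 2).const_mul 3)).mul_const (2⁻¹ : ℝ)).fderiv]
    simp
    ring
  · rw [e2.fderiv_eq, ((a.const_mul 2).fun_mul ((a.pow 2).fun_add (b.pow 2))).fderiv]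
    simp
    ring
  · simp only [div_eq_mul_inv]
    rw [(c.fun_add (((((a.pow 4).const_mul 3).fun_add (((a.pow 2).const_mul 10).fun_mul (b.pow 2))).fun_sub
      (b.pow 4)).mul_const (4⁻¹ : ℝ))).fderiv]
    simp
    ring

lemma core_jac {a b aq at' bq bt yq yt xq xt u3q u3t : ℝ} (hb : 0 < b)
    (s1 : (b * bt - 3 * a * at') + ((6 * a ^ 2 + 2 * b ^ 2) * aq + 4 * a * b * bq) = 0)
    (s2 : ((6 * a ^ 2 + 2 * b ^ 2) * at' + 4 * a * b * bt) + u3q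
      - (b ^ 2 - 3 * a ^ 2) * (b * bq - 3 * a * aq) = 0)
    (s3 : u3t - 2 * a * (a ^ 2 + b ^ 2) * (b * bq - 3 * a * aq) = 0)
    (hyq : yq = 2 * b ^ 3 * aq + 6 * a * b ^ 2 * bq)
    (hyt : yt = 2 * b ^ 3 * at' + 6 * a * b ^ 2 * bt)
    (hxq : xq = u3q + (3 * a ^ 3 + 5 * a * b ^ 2) * aq + (5 * a ^ 2 * b - b ^ 3) * bq)
    (hxt : xt = u3t + (3 * a ^ 3 + 5 * a * b ^ 2) * at' + (5 * a ^ 2 * b - b ^ 3) * bt) :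
    b * xq = -(yt + a * yq) ∧ xt = b * yq - a * xq ∧
    yq * xt - yt * xq = ((yt + a * yq) ^ 2 + b ^ 2 * yq ^ 2) / b := by
  have h1 : b * xq = -(yt + a * yq) := by
    rw [hyq, hyt, hxq]
    linear_combination 2 * a * b * s1 + b * s2
  have h2 : xt = b * yq - a * xq := by
    rw [hyq, hxq, hxt]
    linear_combination (a ^ 2 - b ^ 2) * s1 + a * s2 + s3
  refine ⟨h1, h2, ?_⟩
  rw [eq_div_iff hb.ne', h2]
  linear_combination (-(yt + a * yq)) * h1

lemma core_bound (a b : ℝ) :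
    (2 * a * b ^ 3) ^ 6 ≤ (4 * b ^ 2 * (9 * a ^ 2 + b ^ 2) ^ 2) ^ 4 := by
  have h1 : (9 * a ^ 2) ^ 3 ≤ (9 * a ^ 2 + b ^ 2) ^ 3 := by gcongr; nlinarith [sq_nonneg b]
  have h2 : (b ^ 2) ^ 5 ≤ (9 * a ^ 2 + b ^ 2) ^ 5 := by gcongr; nlinarith [sq_nonneg a]
  calc (2 * a * b ^ 3) ^ 6 = 64 * b ^ 8 * (a ^ 6 * (b ^ 2) ^ 5) := by ring
    _ ≤ 256 * b ^ 8 * ((9 * a ^ 2) ^ 3 * (b ^ 2) ^ 5) := by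
        have : 0 ≤ b ^ 8 * (a ^ 6 * (b ^ 2) ^ 5) := by positivity
        nlinarith
    _ ≤ 256 * b ^ 8 * ((9 * a ^ 2 + b ^ 2) ^ 3 * (9 * a ^ 2 + b ^ 2) ^ 5) := by gcongr
    _ = _ := by ring

open Classical in
lemma core_main (hO : IsOpen Ω)
    (h1 : ContDiff ℝ 2 U1) (h2 : ContDiff ℝ 2 U2) (h3 : ContDiff ℝ 2 U3)
    (hA : ContDiffOn ℝ 2 A Ω) (hB : ContDiffOn ℝ 2 B Ω)
    (p3 : BPer U3) (pA : BPer A) (pB : BPer B)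
    (pΩ1 : ∀ z, z + (1, 0) ∈ Ω ↔ z ∈ Ω) (pΩ2 : ∀ z, z + (0, 1) ∈ Ω ↔ z ∈ Ω)
    (hBpos : ∀ z ∈ Ω, 0 < B z)
    (hE : ∀ z, 0 < 32 * U1 z ^ 3 + 27 * U2 z ^ 2 → z ∈ Ω)
    (r1 : ∀ z ∈ Ω, 2 * U1 z = B z ^ 2 - 3 * A z ^ 2)
    (r2 : ∀ z ∈ Ω, U2 z = 2 * A z * (A z ^ 2 + B z ^ 2))
    (s1 : ∀ z, fderiv ℝ U1 z (0, 1) + fderiv ℝ U2 z (1, 0) = 0)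
    (s2 : ∀ z, fderiv ℝ U2 z (0, 1) + fderiv ℝ U3 z (1, 0)
      - 2 * U1 z * fderiv ℝ U1 z (1, 0) = 0)
    (s3 : ∀ z, fderiv ℝ U3 z (0, 1) - U2 z * fderiv ℝ U1 z (1, 0) = 0) :
    (∀ z ∈ Ω, A z = 0) ∨ (∀ z w, U1 z = U1 w ∧ U2 z = U2 w ∧ U3 z = U3 w) := by
  by_contra hcon
  push Not at hcon
  obtain ⟨⟨z0, hz0, hA0⟩, hnc⟩ := hcon
  set y : ℝ × ℝ → ℝ := fun z => 2 * A z * B z ^ 3 with hy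
  set x : ℝ × ℝ → ℝ :=
    fun z => U3 z + (3 * A z ^ 4 + 10 * A z ^ 2 * B z ^ 2 - B z ^ 4) / 4 with hx
  have hd3 := h3.differentiable two_ne_zero
  have hdA := hA.differentiableOn two_ne_zero
  have hdB := hB.differentiableOn two_ne_zero
  have D := core_derivs hO hd3 hdA hdB r1 r2
  have py : BPer y := ⟨fun z => by simp [hy, pA.1, pB.1], fun z => by simp [hy, pA.2, pB.2]⟩
  have px : BPer x := ⟨fun z => by simp [hx, pA.1, pB.1, p3.1],
    fun z => by simp [hx, pA.2, pB.2, p3.2]⟩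
  have cy : ∀ z ∈ Ω, ContDiffAt ℝ 2 y z := fun z hz => by
    have a := hA.contDiffAt (hO.mem_nhds hz)
    have b := hB.contDiffAt (hO.mem_nhds hz)
    exact (contDiffAt_const.mul a).mul (b.pow 3)
  have cx : ∀ z ∈ Ω, ContDiffAt ℝ 2 x z := fun z hz => by
    have a := hA.contDiffAt (hO.mem_nhds hz)
    have b := hB.contDiffAt (hO.mem_nhds hz)
    exact h3.contDiffAt.add ((((contDiffAt_const.mul (a.pow 4)).add
      ((contDiffAt_const.mul (a.pow 2)).mul (b.pow 2))).sub (b.pow 4)).div_const 4)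
  have J : ∀ z ∈ Ω, B z * fderiv ℝ x z (1, 0)
        = -(fderiv ℝ y z (0, 1) + A z * fderiv ℝ y z (1, 0)) ∧
      fderiv ℝ x z (0, 1) = B z * fderiv ℝ y z (1, 0) - A z * fderiv ℝ x z (1, 0) ∧
      fderiv ℝ y z (1, 0) * fderiv ℝ x z (0, 1) - fderiv ℝ y z (0, 1) * fderiv ℝ x z (1, 0)
        = ((fderiv ℝ y z (0, 1) + A z * fderiv ℝ y z (1, 0)) ^ 2
            + B z ^ 2 * fderiv ℝ y z (1, 0) ^ 2) / B z := by
    intro z hz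
    obtain ⟨q1, q2, q3, q4⟩ := D z hz (1, 0)
    obtain ⟨t1, t2, t3, t4⟩ := D z hz (0, 1)
    have k1 := s1 z
    have k2 := s2 z
    have k3 := s3 z
    rw [t2, q3] at k1
    rw [t3, q2, r1 z hz] at k2
    rw [q2, r2 z hz] at k3
    exact core_jac (hBpos z hz) k1 k2 k3 q1 t1 q4 t4
  -- the cutoff argument
  have main : ∀ ε > 0, ∀ G : ℝ → ℝ, ContDiff ℝ 2 G → (∀ s, s ^ 2 ≤ ε → G s = 0) →
      (∀ s, 0 ≤ deriv G s) →
      (∀ z w, (if z ∈ Ω then G (y z) else 0) = (if w ∈ Ω then G (y w) else 0)) ∧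
      (∀ z ∈ Ω, 0 < deriv G (y z) → fderiv ℝ y z = 0) := by
    intro ε hε G hG hG0 hG'
    -- near points outside Ω
    have hout : ∀ z, z ∉ Ω → ∀ᶠ w in nhds z, w ∈ Ω → G (y w) = 0 := by
      intro z hz
      have hEz : 32 * U1 z ^ 3 + 27 * U2 z ^ 2 ≤ 0 := by
        by_contra h
        exact hz (hE z (not_le.1 h))
      have hcE : Continuous (fun z => (max (32 * U1 z ^ 3 + 27 * U2 z ^ 2) 0) ^ 4) :=
        (((continuous_const.mul (h1.continuous.pow 3)).add
          (continuous_const.mul (h2.continuous.pow 2))).max continuous_const).pow 4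
      have : ∀ᶠ w in nhds z, (max (32 * U1 w ^ 3 + 27 * U2 w ^ 2) 0) ^ 4 < ε ^ 3 := by
        apply hcE.continuousAt.eventually_lt continuousAt_const
        rw [max_eq_right hEz]
        have : 0 < ε ^ 3 := by positivity
        simpa using this
      filter_upwards [this] with w hw hwΩ
      apply hG0
      have e : 32 * U1 w ^ 3 + 27 * U2 w ^ 2 = 4 * B w ^ 2 * (9 * A w ^ 2 + B w ^ 2) ^ 2 := by
        have a1 : U1 w = (B w ^ 2 - 3 * A w ^ 2) / 2 := by have := r1 w hwΩ; linarith
        rw [a1, r2 w hwΩ]; ring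
      rw [e, max_eq_left (by positivity)] at hw
      have := core_bound (A w) (B w)
      by_contra hlt
      rw [not_le] at hlt
      have h6 : ε ^ 3 < (y w ^ 2) ^ 3 := by gcongr
      have h7 : (y w ^ 2) ^ 3 = (2 * A w * B w ^ 3) ^ 6 := by simp only [hy]; ring
      linarith
    have glue : ∀ f : ℝ × ℝ → ℝ, (∀ z ∈ Ω, ContDiffAt ℝ 1 f z) →
        ContDiff ℝ 1 (fun z => if z ∈ Ω then G (y z) * f z else 0) ∧
        (∀ z ∈ Ω, (fun z => if z ∈ Ω then G (y z) * f z else 0) =ᶠ[nhds z]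
          fun z => G (y z) * f z) ∧
        (∀ z ∉ Ω, fderiv ℝ (fun z => if z ∈ Ω then G (y z) * f z else 0) z = 0) := by
      intro f hf
      have i1 : ∀ z ∈ Ω, (fun z => if z ∈ Ω then G (y z) * f z else 0) =ᶠ[nhds z]
          fun z => G (y z) * f z := by
        intro z hz
        filter_upwards [hO.mem_nhds hz] with w hw
        simp [hw]
      have i2 : ∀ z ∉ Ω, (fun z => if z ∈ Ω then G (y z) * f z else 0) =ᶠ[nhds z]
          fun z => 0 := by
        intro z hz
        filter_upwards [hout z hz] with w hw
        by_cases h : w ∈ Ω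
        · simp [h, hw h]
        · simp [h]
      refine ⟨?_, i1, fun z hz => ?_⟩
      · rw [contDiff_iff_contDiffAt]
        intro z
        by_cases hz : z ∈ Ω
        · refine ContDiffAt.congr_of_eventuallyEq ?_ (i1 z hz)
          exact ((hG.contDiffAt.comp z (cy z hz)).of_le (by norm_num)).mul (hf z hz)
        · exact contDiffAt_const.congr_of_eventuallyEq (i2 z hz)
      · rw [(i2 z hz).fderiv_eq]; simp
    have cxv : ∀ v, ∀ z ∈ Ω, ContDiffAt ℝ 1 (fun z => fderiv ℝ x z v) z := fun v z hz =>
      ((cx z hz).fderiv_right (m := 1) (by norm_num)).clm_apply contDiffAt_const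
    have hGy : ∀ z ∈ Ω, HasFDerivAt (fun z => G (y z)) (deriv G (y z) • fderiv ℝ y z) z :=
      fun z hz => (hG.differentiable two_ne_zero (y z)).hasDerivAt.comp_hasFDerivAt z
        ((cy z hz).differentiableAt two_ne_zero).hasFDerivAt
    obtain ⟨P1, P2, P3⟩ := glue (fun z => fderiv ℝ x z (0, 1)) (cxv _)
    obtain ⟨Q1, Q2, Q3⟩ := glue (fun z => - fderiv ℝ x z (1, 0)) (fun z hz => (cxv _ z hz).neg)
    obtain ⟨R1, R2, R3⟩ := glue (fun z => 1) (fun z hz => contDiffAt_const)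
    have perG : ∀ f : ℝ × ℝ → ℝ, BPer f → BPer (fun z => if z ∈ Ω then G (y z) * f z else 0) :=
      fun f hf => ⟨fun z => by simp only [pΩ1, py.1, hf.1], fun z => by simp only [pΩ2, py.2, hf.2]⟩
    have pxq := bper_fderiv px (1, 0)
    have divE : ∀ z ∈ Ω,
        fderiv ℝ (fun z => if z ∈ Ω then G (y z) * fderiv ℝ x z (0, 1) else 0) z (1, 0)
        + fderiv ℝ (fun z => if z ∈ Ω then G (y z) * -fderiv ℝ x z (1, 0) else 0) z (0, 1)
        = deriv G (y z) * (((fderiv ℝ y z (0, 1) + A z * fderiv ℝ y z (1, 0)) ^ 2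
            + B z ^ 2 * fderiv ℝ y z (1, 0) ^ 2) / B z) := by
      intro z hz
      rw [(P2 z hz).fderiv_eq, (Q2 z hz).fderiv_eq, ← (J z hz).2.2]
      have d1 := ((cxv (0, 1) z hz).differentiableAt one_ne_zero).hasFDerivAt
      have d2 := ((cxv (1, 0) z hz).differentiableAt one_ne_zero).hasFDerivAt
      rw [((hGy z hz).fun_mul d1).fderiv, ((hGy z hz).fun_mul d2.fun_neg).fderiv]
      have := fderiv2_comm (cx z hz) (1, 0) (0, 1)
      simp [this]
      ring
    have hz' := bper_div_zero P1 Q1 (perG _ (bper_fderiv px _))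
      (perG _ ⟨fun z => by simp only [pxq.1 z], fun z => by simp only [pxq.2 z]⟩) (by
        intro z
        by_cases hz : z ∈ Ω
        · rw [divE z hz]
          have := hG' (y z)
          have := hBpos z hz
          positivity
        · rw [P3 z hz, Q3 z hz]; simp)
    have hzero : ∀ z ∈ Ω, deriv G (y z) = 0 ∨ fderiv ℝ y z = 0 := by
      intro z hz
      have h := hz' z
      rw [divE z hz] at h
      rcases mul_eq_zero.1 h with h | h
      · exact Or.inl h
      · right
        have hb := hBpos z hz
        rw [div_eq_zero_iff, or_iff_left hb.ne'] at h
        have k1 : B z ^ 2 * fderiv ℝ y z (1, 0) ^ 2 = 0 := by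
          have := sq_nonneg (fderiv ℝ y z (0, 1) + A z * fderiv ℝ y z (1, 0))
          have : 0 ≤ B z ^ 2 * fderiv ℝ y z (1, 0) ^ 2 := by positivity
          linarith
        have k2 : fderiv ℝ y z (1, 0) = 0 := by
          simpa [hb.ne'] using k1
        have k3 : fderiv ℝ y z (0, 1) = 0 := by
          rw [k2] at h
          simpa using h
        ext <;> simp [k2, k3]
    constructor
    · intro z w
      have := is_const_of_fderiv_eq_zero (R1.differentiable one_ne_zero) (by
        intro z
        by_cases hz : z ∈ Ω
        · rw [(R2 z hz).fderiv_eq]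
          simp only [mul_one]
          rw [(hGy z hz).fderiv]
          rcases hzero z hz with h | h <;> simp [h]
        · exact R3 z hz) z w
      simpa using this
    · intro z hz hp
      exact (hzero z hz).resolve_left hp.ne'
  have hy0 : y z0 ≠ 0 := by
    have := hBpos z0 hz0
    simp only [hy]
    positivity
  have huniv : ∀ z, z ∈ Ω ∧ y z ≠ 0 := by
    intro z
    obtain ⟨G, g1, g2, g3, g4⟩ := exists_cutoff (y z0 ^ 2 / 2)
    have hpos : 0 < y z0 ^ 2 := by positivity
    have := (main (y z0 ^ 2 / 2) (by positivity) G g1 g2 g3).1 z z0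
    rw [if_pos hz0] at this
    have hne := (g4 (y z0) (by linarith) hy0).1
    by_cases hz : z ∈ Ω
    · refine ⟨hz, fun h => ?_⟩
      rw [if_pos hz, h, g2 0 (by simp; positivity)] at this
      exact hne this.symm
    · rw [if_neg hz] at this
      exact absurd this.symm hne
  have hdy : ∀ z, fderiv ℝ y z = 0 := by
    intro z
    have hyz := (huniv z).2
    have hpos : 0 < y z ^ 2 := by positivity
    obtain ⟨G, g1, g2, g3, g4⟩ := exists_cutoff (y z ^ 2 / 2)
    exact (main (y z ^ 2 / 2) (by positivity) G g1 g2 g3).2 z (huniv z).1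
      (g4 (y z) (by linarith) hyz).2
  have hAne : ∀ z, A z ≠ 0 := fun z h => (huniv z).2 (by simp [hy, h])
  have hrel : ∀ z v, B z * fderiv ℝ A z v + 3 * A z * fderiv ℝ B z v = 0 := by
    intro z v
    have k := (D z (huniv z).1 v).1
    have hb := hBpos z (huniv z).1
    change fderiv ℝ y z v = _ at k
    rw [hdy] at k
    have : (2 * B z ^ 2) * (B z * fderiv ℝ A z v + 3 * A z * fderiv ℝ B z v) = 0 := by
      simp at k
      linear_combination -k
    exact (mul_eq_zero.1 this).resolve_left (by positivity)
  have hΩ : Ω = Set.univ := Set.eq_univ_of_forall fun z => (huniv z).1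
  have hAc : ContDiff ℝ 2 A := by rw [hΩ] at hA; exact contDiffOn_univ.1 hA
  have hdA0 : ∀ z, fderiv ℝ A z = 0 := by
    apply burgers_const hAc pA
    intro z
    have hz := (huniv z).1
    have hb := hBpos z hz
    obtain ⟨q1, q2, q3, q4⟩ := D z hz (1, 0)
    obtain ⟨t1, t2, t3, t4⟩ := D z hz (0, 1)
    have k1 := s1 z
    rw [t2, q3] at k1
    have e1 := hrel z (1, 0)
    have e2 := hrel z (0, 1)
    have : (B z ^ 2 + 9 * A z ^ 2) *
        (fderiv ℝ A z (0, 1) - 2 * A z * fderiv ℝ A z (1, 0)) = 0 := by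
      linear_combination (-3 * A z) * k1 + B z * e2 + 4 * A z * B z * e1
    have := (mul_eq_zero.1 this).resolve_left (by positivity)
    linarith
  have hdB0 : ∀ z, fderiv ℝ B z = 0 := by
    intro z
    have hv : ∀ v, fderiv ℝ B z v = 0 := by
      intro v
      have := hrel z v
      rw [hdA0] at this
      simpa [hAne z] using this
    ext <;> simp [hv]
  have hU1 : ∀ z, fderiv ℝ U1 z = 0 := by
    intro z
    ext <;> simp [(D z (huniv z).1 _).2.1, hdA0, hdB0]
  have hU2 : ∀ z, fderiv ℝ U2 z = 0 := by
    intro z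
    ext <;> simp [(D z (huniv z).1 _).2.2.1, hdA0, hdB0]
  have hU3 : ∀ z, fderiv ℝ U3 z = 0 := by
    intro z
    have k2 := s2 z
    have k3 := s3 z
    rw [hU1, hU2] at k2
    rw [hU1] at k3
    simp at k2 k3
    ext <;> simp [k2, k3]
  obtain ⟨z, w, h⟩ := hnc
  exact h (is_const_of_fderiv_eq_zero (h1.differentiable two_ne_zero) hU1 z w)
    (is_const_of_fderiv_eq_zero (h2.differentiable two_ne_zero) hU2 z w)
    (is_const_of_fderiv_eq_zero (h3.differentiable two_ne_zero) hU3 z w)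

end core

open Complex in
lemma root_iff (a b u v : ℝ) (hb : 0 < b) :
    ((a : ℂ) + b * I) ^ 3 + 2 * (u : ℂ) * ((a : ℂ) + b * I) + (v : ℂ) = 0 ↔
      (2 * u = b ^ 2 - 3 * a ^ 2 ∧ v = 2 * a * (a ^ 2 + b ^ 2)) := by
  have e : ((a : ℂ) + b * I) ^ 3 + 2 * (u : ℂ) * ((a : ℂ) + b * I) + (v : ℂ)
      = ((a ^ 3 - 3 * a * b ^ 2 + 2 * u * a + v : ℝ) : ℂ)
        + ((3 * a ^ 2 * b - b ^ 3 + 2 * u * b : ℝ) : ℂ) * I := by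
    push_cast
    linear_combination (3 * (a : ℂ) * b ^ 2 + b ^ 3 * I) * I_sq
  rw [e, Complex.ext_iff]
  simp only [add_re, ofReal_re, mul_re, I_re, mul_zero, ofReal_im, I_im, mul_one, sub_self,
    add_zero, zero_re, add_im, mul_im, zero_im, zero_add]
  constructor
  · rintro ⟨h1, h2⟩
    have h3 : 2 * u = b ^ 2 - 3 * a ^ 2 := by
      have : b * (2 * u - (b ^ 2 - 3 * a ^ 2)) = 0 := by linear_combination h2
      have := (mul_eq_zero.1 this).resolve_left hb.ne'
      linarith
    exact ⟨h3, by linear_combination h1 - a * h3⟩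
  · rintro ⟨h1, h2⟩
    exact ⟨by linear_combination a * h1 + h2, by linear_combination b * h1⟩

lemma root_unique {a b a' b' u v : ℝ} (hb : 0 < b) (hb' : 0 < b')
    (h1 : 2 * u = b ^ 2 - 3 * a ^ 2) (h2 : v = 2 * a * (a ^ 2 + b ^ 2))
    (h1' : 2 * u = b' ^ 2 - 3 * a' ^ 2) (h2' : v = 2 * a' * (a' ^ 2 + b' ^ 2)) :
    a = a' ∧ b = b' := by
  have hb2 : 0 < b ^ 2 := by positivity
  have hb2' : 0 < b' ^ 2 := by positivity
  have e : (a - a') * (8 * (a ^ 2 + a * a' + a' ^ 2) + 4 * u) = 0 := by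
    linear_combination h2' - h2 + 2 * a * h1 - 2 * a' * h1'
  have hp : 0 < 8 * (a ^ 2 + a * a' + a' ^ 2) + 4 * u := by
    nlinarith [sq_nonneg (a + a'), sq_nonneg a, sq_nonneg a']
  have ha : a = a' := by
    have := (mul_eq_zero.1 e).resolve_right hp.ne'
    linarith
  refine ⟨ha, ?_⟩
  subst ha
  have : b ^ 2 = b' ^ 2 := by linarith
  exact (pow_left_inj₀ hb.le hb'.le two_ne_zero).1 this

lemma cubic_root (u v : ℝ) : ∃ s : ℝ, s ^ 3 + 2 * u * s + v = 0 := by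
  set M : ℝ := 1 + 2 * |u| + |v| with hM
  have hu := abs_nonneg u
  have hv := abs_nonneg v
  have hu1 := neg_abs_le u
  have hu2 := le_abs_self u
  have hv1 := neg_abs_le v
  have hv2 := le_abs_self v
  have hM1 : 1 ≤ M := by linarith
  have h3 : 2 * |u| * M + |v| ≤ M ^ 3 := by
    have : M * M ≤ M ^ 3 := by nlinarith [mul_nonneg (sub_nonneg.2 hM1) (mul_self_nonneg M)]
    have h4 : |v| ≤ |v| * M := by nlinarith
    nlinarith
  have k : |u| * M ≥ u * M := by gcongr
  have k' : -|u| * M ≤ u * M := by gcongr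
  have hc : ContinuousOn (fun s : ℝ => s ^ 3 + 2 * u * s + v) (Set.Icc (-M) M) := by fun_prop
  have := intermediate_value_Icc (by linarith : -M ≤ M) hc
  obtain ⟨s, -, hs⟩ := this (show (0 : ℝ) ∈ _ from ⟨by nlinarith, by nlinarith⟩)
  exact ⟨s, hs⟩

lemma disc_pos {u v : ℝ} (h : 0 < 32 * u ^ 3 + 27 * v ^ 2) :
    ∃ a b : ℝ, 0 < b ∧ 2 * u = b ^ 2 - 3 * a ^ 2 ∧ v = 2 * a * (a ^ 2 + b ^ 2) := by
  obtain ⟨s, hs⟩ := cubic_root u v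
  have hv : v = -(s ^ 3 + 2 * u * s) := by linarith
  have e : 32 * u ^ 3 + 27 * v ^ 2 = (8 * u + 3 * s ^ 2) * (2 * u + 3 * s ^ 2) ^ 2 := by
    rw [hv]; ring
  have hp : 0 < 8 * u + 3 * s ^ 2 := by
    rw [e] at h
    exact pos_of_mul_pos_left h (sq_nonneg _)
  have hsq := Real.sq_sqrt hp.le
  refine ⟨-s / 2, Real.sqrt (8 * u + 3 * s ^ 2) / 2, by positivity, ?_, ?_⟩
  · rw [div_pow (√_), hsq]; ring
  · rw [div_pow (√_), hsq, hv]; ring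

lemma deriv_slice_t {f : ℝ → ℝ → ℝ} (hf : Differentiable ℝ (fun z : ℝ × ℝ => f z.1 z.2))
    (q t : ℝ) : deriv (fun s => f q s) t = fderiv ℝ (fun z : ℝ × ℝ => f z.1 z.2) (q, t) (0, 1) := by
  have h : HasDerivAt (fun s : ℝ => (q, s)) ((0 : ℝ), (1 : ℝ)) t :=
    (hasDerivAt_const t q).prodMk (hasDerivAt_id t)
  exact ((hf (q, t)).hasFDerivAt.comp_hasDerivAt t h).deriv

lemma deriv_slice_q {f : ℝ → ℝ → ℝ} (hf : Differentiable ℝ (fun z : ℝ × ℝ => f z.1 z.2))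
    (q t : ℝ) : deriv (fun s => f s t) q = fderiv ℝ (fun z : ℝ × ℝ => f z.1 z.2) (q, t) (1, 0) := by
  have h : HasDerivAt (fun s : ℝ => (s, t)) ((1 : ℝ), (0 : ℝ)) q :=
    (hasDerivAt_id q).prodMk (hasDerivAt_const q t)
  exact ((hf (q, t)).hasFDerivAt.comp_hasDerivAt q h).deriv

open Complex in
/-- description of a smooth periodic solution of the n = 3 Benney
reduction on the elliptic region `Ω_e`: either the solution is constant, or
`Ω_e` is a union of strips parallel to the `t`-axis, on it `u₂ = 0`, `α = 0`,
`β² = 2u₁`, `∂_t u₁ = 0`, and on each connected component `u₃ = u₁² + c`, so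
that `F = (p²/2 + u₁(q))² + c`. -/
theorem elliptic_region_description
    (u₁ u₂ u₃ : ℝ → ℝ → ℝ)
    (hu₁ : ContDiff ℝ (⊤ : ℕ∞) (fun z : ℝ × ℝ => u₁ z.1 z.2))
    (hu₂ : ContDiff ℝ (⊤ : ℕ∞) (fun z : ℝ × ℝ => u₂ z.1 z.2))
    (hu₃ : ContDiff ℝ (⊤ : ℕ∞) (fun z : ℝ × ℝ => u₃ z.1 z.2))
    (hq₁ : ∀ t, Function.Periodic (fun q => u₁ q t) 1)
    (hq₂ : ∀ t, Function.Periodic (fun q => u₂ q t) 1)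
    (hq₃ : ∀ t, Function.Periodic (fun q => u₃ q t) 1)
    (ht₁ : ∀ q, Function.Periodic (fun t => u₁ q t) 1)
    (ht₂ : ∀ q, Function.Periodic (fun t => u₂ q t) 1)
    (ht₃ : ∀ q, Function.Periodic (fun t => u₃ q t) 1)
    (hsys₁ : ∀ q t, deriv (fun s => u₁ q s) t + deriv (fun x => u₂ x t) q = 0)
    (hsys₂ : ∀ q t, deriv (fun s => u₂ q s) t + deriv (fun x => u₃ x t) q
        - 2 * u₁ q t * deriv (fun x => u₁ x t) q = 0)
    (hsys₃ : ∀ q t, deriv (fun s => u₃ q s) t - u₂ q t * deriv (fun x => u₁ x t) q = 0)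
    (Ωe : Set (ℝ × ℝ)) (hΩe_open : IsOpen Ωe)
    (hΩe : ∀ z : ℝ × ℝ, z ∈ Ωe ↔ ∃ a b : ℝ, 0 < b ∧
      ((a : ℂ) + b * I) ^ 3 + 2 * (u₁ z.1 z.2 : ℂ) * ((a : ℂ) + b * I)
        + (u₂ z.1 z.2 : ℂ) = 0)
    (α β : ℝ × ℝ → ℝ)
    (hα : ContDiffOn ℝ (⊤ : ℕ∞) α Ωe) (hβ : ContDiffOn ℝ (⊤ : ℕ∞) β Ωe)
    (hβpos : ∀ z ∈ Ωe, 0 < β z)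
    (hroot : ∀ z ∈ Ωe,
      ((α z : ℂ) + β z * I) ^ 3 + 2 * (u₁ z.1 z.2 : ℂ) * ((α z : ℂ) + β z * I)
        + (u₂ z.1 z.2 : ℂ) = 0) :
    (∃ c₁ c₂ c₃ : ℝ, ∀ q t, u₁ q t = c₁ ∧ u₂ q t = c₂ ∧ u₃ q t = c₃) ∨
    ((∀ q t t' : ℝ, (q, t) ∈ Ωe → (q, t') ∈ Ωe) ∧
     (∀ z ∈ Ωe, u₂ z.1 z.2 = 0 ∧ α z = 0 ∧ β z ^ 2 = 2 * u₁ z.1 z.2 ∧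
        deriv (fun s => u₁ z.1 s) z.2 = 0) ∧
     (∀ z ∈ Ωe, ∃ c : ℝ, ∀ w ∈ connectedComponentIn Ωe z,
        u₃ w.1 w.2 = u₁ w.1 w.2 ^ 2 + c ∧
        ∀ p : ℝ, p ^ 4 / 4 + u₁ w.1 w.2 * p ^ 2 + u₂ w.1 w.2 * p + u₃ w.1 w.2
          = (p ^ 2 / 2 + u₁ w.1 w.2) ^ 2 + c)) := by

  set U1 : ℝ × ℝ → ℝ := fun z => u₁ z.1 z.2 with hU1
  set U2 : ℝ × ℝ → ℝ := fun z => u₂ z.1 z.2 with hU2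
  set U3 : ℝ × ℝ → ℝ := fun z => u₃ z.1 z.2 with hU3
  have le2 : (2 : WithTop ℕ∞) ≤ ((⊤ : ℕ∞) : WithTop ℕ∞) := by
    exact WithTop.coe_le_coe.2 (le_top : (2 : ℕ∞) ≤ ⊤)
  have c1 : ContDiff ℝ 2 U1 := hu₁.of_le le2
  have c2 : ContDiff ℝ 2 U2 := hu₂.of_le le2
  have c3 : ContDiff ℝ 2 U3 := hu₃.of_le le2
  have d1 := c1.differentiable two_ne_zero
  have d2 := c2.differentiable two_ne_zero
  have d3 := c3.differentiable two_ne_zero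
  have p1 : BPer U1 := ⟨fun z => by simpa [hU1] using hq₁ z.2 z.1,
    fun z => by simpa [hU1] using ht₁ z.1 z.2⟩
  have p2 : BPer U2 := ⟨fun z => by simpa [hU2] using hq₂ z.2 z.1,
    fun z => by simpa [hU2] using ht₂ z.1 z.2⟩
  have p3 : BPer U3 := ⟨fun z => by simpa [hU3] using hq₃ z.2 z.1,
    fun z => by simpa [hU3] using ht₃ z.1 z.2⟩
  have s1 : ∀ z, fderiv ℝ U1 z (0, 1) + fderiv ℝ U2 z (1, 0) = 0 := by
    rintro ⟨q, t⟩
    have := hsys₁ q t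
    rwa [deriv_slice_t d1, deriv_slice_q d2] at this
  have s2 : ∀ z, fderiv ℝ U2 z (0, 1) + fderiv ℝ U3 z (1, 0)
      - 2 * U1 z * fderiv ℝ U1 z (1, 0) = 0 := by
    rintro ⟨q, t⟩
    have := hsys₂ q t
    rwa [deriv_slice_t d2, deriv_slice_q d3, deriv_slice_q d1] at this
  have s3 : ∀ z, fderiv ℝ U3 z (0, 1) - U2 z * fderiv ℝ U1 z (1, 0) = 0 := by
    rintro ⟨q, t⟩
    have := hsys₃ q t
    rwa [deriv_slice_t d3, deriv_slice_q d1] at this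
  have r1 : ∀ z ∈ Ωe, 2 * U1 z = β z ^ 2 - 3 * α z ^ 2 := fun z hz =>
    ((root_iff _ _ _ _ (hβpos z hz)).1 (hroot z hz)).1
  have r2 : ∀ z ∈ Ωe, U2 z = 2 * α z * (α z ^ 2 + β z ^ 2) := fun z hz =>
    ((root_iff _ _ _ _ (hβpos z hz)).1 (hroot z hz)).2
  have hE : ∀ z, 0 < 32 * U1 z ^ 3 + 27 * U2 z ^ 2 → z ∈ Ωe := by
    intro z hz
    obtain ⟨a, b, hb, h⟩ := disc_pos hz
    exact (hΩe z).2 ⟨a, b, hb, (root_iff _ _ _ _ hb).2 h⟩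
  have hE' : ∀ z ∈ Ωe, 0 < 32 * U1 z ^ 3 + 27 * U2 z ^ 2 := by
    intro z hz
    have a1 : U1 z = (β z ^ 2 - 3 * α z ^ 2) / 2 := by have := r1 z hz; linarith
    have e : 32 * U1 z ^ 3 + 27 * U2 z ^ 2 = 4 * β z ^ 2 * (9 * α z ^ 2 + β z ^ 2) ^ 2 := by
      rw [a1, r2 z hz]; ring
    rw [e]
    have := hβpos z hz
    positivity
  have pΩ : ∀ v : ℝ × ℝ, (∀ z, U1 (z + v) = U1 z) → (∀ z, U2 (z + v) = U2 z) →
      ∀ z, z + v ∈ Ωe ↔ z ∈ Ωe := by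
    intro v e1 e2 z
    refine ⟨fun h => hE _ ?_, fun h => hE _ ?_⟩
    · have := hE' _ h
      rwa [e1, e2] at this
    · rw [e1, e2]
      exact hE' _ h
  have pu : ∀ v : ℝ × ℝ, (∀ z, U1 (z + v) = U1 z) → (∀ z, U2 (z + v) = U2 z) →
      ∀ z ∈ Ωe, α (z + v) = α z ∧ β (z + v) = β z := by
    intro v e1 e2 z hz
    have hz' := (pΩ v e1 e2 z).2 hz
    have k1 := r1 _ hz'
    have k2 := r2 _ hz'
    rw [e1] at k1
    rw [e2] at k2
    exact root_unique (hβpos _ hz') (hβpos z hz) k1 k2 (r1 z hz) (r2 z hz)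
  have pind : ∀ v : ℝ × ℝ, (∀ z, U1 (z + v) = U1 z) → (∀ z, U2 (z + v) = U2 z) → ∀ z,
      Ωe.indicator α (z + v) = Ωe.indicator α z ∧ Ωe.indicator β (z + v) = Ωe.indicator β z := by
    intro v e1 e2 z
    by_cases hz : z ∈ Ωe
    · have hz' := (pΩ v e1 e2 z).2 hz
      simp [hz, hz', pu v e1 e2 z hz]
    · have hz' : z + v ∉ Ωe := fun h => hz ((pΩ v e1 e2 z).1 h)
      simp [hz, hz']
  have main := core_main (A := Ωe.indicator α) (B := Ωe.indicator β) hΩe_open c1 c2 c3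
    ((hα.of_le le2).congr fun z hz => Set.indicator_of_mem hz _)
    ((hβ.of_le le2).congr fun z hz => Set.indicator_of_mem hz _) p3
    ⟨fun z => (pind _ p1.1 p2.1 z).1, fun z => (pind _ p1.2 p2.2 z).1⟩
    ⟨fun z => (pind _ p1.1 p2.1 z).2, fun z => (pind _ p1.2 p2.2 z).2⟩
    (pΩ _ p1.1 p2.1) (pΩ _ p1.2 p2.2)
    (fun z hz => by rw [Set.indicator_of_mem hz]; exact hβpos z hz) hE
    (fun z hz => by rw [Set.indicator_of_mem hz, Set.indicator_of_mem hz]; exact r1 z hz)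
    (fun z hz => by rw [Set.indicator_of_mem hz, Set.indicator_of_mem hz]; exact r2 z hz)
    s1 s2 s3
  rcases main with hA | hconst
  swap
  · left
    exact ⟨u₁ 0 0, u₂ 0 0, u₃ 0 0, fun q t => hconst (q, t) (0, 0)⟩
  right
  have hα0 : ∀ z ∈ Ωe, α z = 0 := fun z hz => by
    have := hA z hz
    rwa [Set.indicator_of_mem hz] at this
  have hU20 : ∀ z ∈ Ωe, U2 z = 0 := fun z hz => by rw [r2 z hz, hα0 z hz]; ring
  have hdU2 : ∀ z ∈ Ωe, fderiv ℝ U2 z = 0 := fun z hz => by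
    have : U2 =ᶠ[nhds z] fun _ => 0 := by
      filter_upwards [hΩe_open.mem_nhds hz] with w hw using hU20 w hw
    rw [this.fderiv_eq]; simp
  have hU1t : ∀ z ∈ Ωe, fderiv ℝ U1 z (0, 1) = 0 := fun z hz => by
    have := s1 z
    rw [hdU2 z hz] at this
    simpa using this
  refine ⟨?_, ?_, ?_⟩
  · intro q t t' hz
    set e : ℝ → ℝ := fun s => 32 * u₁ q s ^ 3 + 27 * u₂ q s ^ 2 with he
    have hline : ∀ s, HasDerivAt (fun s : ℝ => (q, s)) ((0 : ℝ), (1 : ℝ)) s := fun s =>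
      (hasDerivAt_const s q).prodMk (hasDerivAt_id s)
    have k1 : ∀ s, HasDerivAt (fun s => u₁ q s) (fderiv ℝ U1 (q, s) (0, 1)) s := fun s =>
      (d1 (q, s)).hasFDerivAt.comp_hasDerivAt s (hline s)
    have k2 : ∀ s, HasDerivAt (fun s => u₂ q s) (fderiv ℝ U2 (q, s) (0, 1)) s := fun s =>
      (d2 (q, s)).hasFDerivAt.comp_hasDerivAt s (hline s)
    have ke : ∀ s, HasDerivAt e _ s := fun s =>
      (((k1 s).fun_pow 3).const_mul 32).fun_add (((k2 s).fun_pow 2).const_mul 27)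
    have hg : ContDiff ℝ 1 expNegInvGlue := expNegInvGlue.contDiff (n := 1)
    have kg : ∀ s, HasDerivAt (fun s => expNegInvGlue (e s)) _ s := fun s =>
      (hg.differentiable one_ne_zero (e s)).hasDerivAt.comp s (ke s)
    have hconst := is_const_of_deriv_eq_zero (f := fun s => expNegInvGlue (e s))
      (fun s => (kg s).differentiableAt) (by
        intro s
        by_cases hs : 0 < e s
        · have hm : (q, s) ∈ Ωe := hE (q, s) hs
          rw [(kg s).deriv, hU1t _ hm, hdU2 _ hm]
          simp
        · apply IsLocalMin.deriv_eq_zero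
          refine Filter.Eventually.of_forall fun s' => ?_
          simp only [expNegInvGlue.zero_of_nonpos (not_lt.1 hs)]
          exact expNegInvGlue.nonneg _) t t'
    have hpos := expNegInvGlue.pos_of_pos (hE' _ hz)
    apply hE (q, t')
    by_contra hneg
    have h0 := expNegInvGlue.zero_of_nonpos (not_lt.1 hneg)
    change expNegInvGlue (e t') = 0 at h0
    change 0 < expNegInvGlue (e t) at hpos
    linarith
  · intro z hz
    refine ⟨hU20 z hz, hα0 z hz, ?_, ?_⟩
    · have := r1 z hz
      rw [hα0 z hz] at this
      change β z ^ 2 = 2 * U1 z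
      linarith
    · rw [deriv_slice_t d1]
      exact hU1t z hz
  · intro z hz
    have hsub := connectedComponentIn_subset Ωe z
    obtain ⟨c, hc⟩ := (hΩe_open.connectedComponentIn (x := z)).exists_is_const_of_fderiv_eq_zero
      (𝕜 := ℝ) (f := fun w => U3 w - U1 w ^ 2) isPreconnected_connectedComponentIn
      (d3.sub (d1.pow 2)).differentiableOn (by
        intro w hw
        have hw' := hsub hw
        have k := ((d3 w).hasFDerivAt.fun_sub ((d1 w).hasFDerivAt.pow 2)).fderiv
        rw [k]
        have a2 := s2 w
        have a3 := s3 w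
        have a1 := hU1t w hw'
        rw [hdU2 w hw'] at a2
        rw [hU20 w hw'] at a3
        simp at a2 a3
        ext
        · simp
          linarith
        · simp [a3, a1])
    refine ⟨c, fun w hw => ?_⟩
    have h1 := hc w hw
    have h2 : u₂ w.1 w.2 = 0 := hU20 w (hsub hw)
    have h3 : u₃ w.1 w.2 = u₁ w.1 w.2 ^ 2 + c := by
      simp only [hU3, hU1] at h1
      linarith
    refine ⟨h3, fun p => ?_⟩
    rw [h2, h3]
    ring
end

section
/- (Blow-up equation along characteristics, n = 3.) Let u₁, u₂, u₃ be a smooth periodic solution of the quasi-linear system and work in the strictly hyperbolic region Ω_h. For i = 1, 2, 3 define z_i(q,t) = |F_pp(λ_i(q,t), q, t)|^{1/2} · ∂_q r_i(q,t), where F_pp(p,q,t) = 3p² + 2u₁(q,t). Then on Ω_h each z_i satisfies the Riccati-type equation ∂_t z_i + λ_i ∂_q z_i + K_i z_i² = 0, where K_i(q,t) = −3λ_i(q,t) / |F_pp(λ_i(q,t), q, t)|^{5/2}. -/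
theorem slice_q {G : ℝ × ℝ → ℝ} {q t : ℝ} (h : DifferentiableAt ℝ G (q, t)) :
    HasDerivAt (fun x => G (x, t)) (fderiv ℝ G (q, t) (1, 0)) q := by
  have h2 : HasDerivAt (fun x : ℝ => (x, t)) ((1 : ℝ), (0 : ℝ)) q :=
    (hasDerivAt_id q).prodMk (hasDerivAt_const q t)
  exact HasFDerivAt.comp_hasDerivAt (f := fun x : ℝ => (x, t)) q h.hasFDerivAt h2

theorem slice_t {G : ℝ × ℝ → ℝ} {q t : ℝ} (h : DifferentiableAt ℝ G (q, t)) :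
    HasDerivAt (fun s => G (q, s)) (fderiv ℝ G (q, t) (0, 1)) t := by
  have h2 : HasDerivAt (fun s : ℝ => (q, s)) ((0 : ℝ), (1 : ℝ)) t :=
    (hasDerivAt_const t q).prodMk (hasDerivAt_id t)
  exact HasFDerivAt.comp_hasDerivAt (f := fun s : ℝ => (q, s)) t h.hasFDerivAt h2

theorem abs_half {f : ℝ → ℝ} {f' x : ℝ} (h : HasDerivAt f f' x) (hx : f x ≠ 0) :
    HasDerivAt (fun y => |f y| ^ ((1 : ℝ) / 2)) (|f x| ^ ((1 : ℝ) / 2) * f' / (2 * f x)) x := by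
  have h0 : HasDerivAt (fun y => |f y|) (SignType.sign (f x) * f') x :=
    HasDerivAt.comp x (hasDerivAt_abs hx) h
  have h1 := h0.rpow_const (p := (1 : ℝ) / 2) (Or.inl (abs_ne_zero.mpr hx))
  convert h1 using 1
  have hpos := abs_pos.mpr hx
  rw [Real.rpow_sub hpos, Real.rpow_one]
  rcases lt_or_gt_of_ne hx with h0 | h0
  · rw [sign_neg h0, abs_of_neg h0]; simp; field_simp
  · rw [sign_pos h0, abs_of_pos h0]; simp; field_simp

theorem nhds_q {Ω : Set (ℝ × ℝ)} (hΩ : IsOpen Ω) {q t : ℝ} (h : (q, t) ∈ Ω) :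
    ∀ᶠ x in nhds q, (x, t) ∈ Ω :=
  (Continuous.prodMk_left t).continuousAt.eventually (hΩ.mem_nhds h)

theorem nhds_t {Ω : Set (ℝ × ℝ)} (hΩ : IsOpen Ω) {q t : ℝ} (h : (q, t) ∈ Ω) :
    ∀ᶠ s in nhds t, (q, s) ∈ Ω :=
  (Continuous.prodMk_right q).continuousAt.eventually (hΩ.mem_nhds h)

theorem core (Ω : Set (ℝ × ℝ)) (hΩ : IsOpen Ω) (a b c L R : ℝ × ℝ → ℝ)
    (ha : ContDiff ℝ (⊤ : ℕ∞) a) (hb : ContDiff ℝ (⊤ : ℕ∞) b) (hc : ContDiff ℝ (⊤ : ℕ∞) c)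
    (hL : ContDiffOn ℝ (⊤ : ℕ∞) L Ω)
    (s1 : ∀ p, fderiv ℝ a p (0, 1) + fderiv ℝ b p (1, 0) = 0)
    (s2 : ∀ p, fderiv ℝ b p (0, 1) + fderiv ℝ c p (1, 0) - 2 * a p * fderiv ℝ a p (1, 0) = 0)
    (s3 : ∀ p, fderiv ℝ c p (0, 1) - b p * fderiv ℝ a p (1, 0) = 0)
    (hroot : ∀ p ∈ Ω, L p ^ 3 + 2 * a p * L p + b p = 0)
    (hA : ∀ p ∈ Ω, 3 * L p ^ 2 + 2 * a p ≠ 0)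
    (hR : ∀ p, R p = L p ^ 4 / 4 + a p * L p ^ 2 + b p * L p + c p)
    (q t : ℝ) (hp : (q, t) ∈ Ω) :
    deriv (fun s => |3 * L (q, s) ^ 2 + 2 * a (q, s)| ^ ((1 : ℝ) / 2)
        * deriv (fun x => R (x, s)) q) t
      + L (q, t) * deriv (fun y => |3 * L (y, t) ^ 2 + 2 * a (y, t)| ^ ((1 : ℝ) / 2)
        * deriv (fun x => R (x, t)) y) q
      + (-3 * L (q, t) / |3 * L (q, t) ^ 2 + 2 * a (q, t)| ^ ((5 : ℝ) / 2))
        * (|3 * L (q, t) ^ 2 + 2 * a (q, t)| ^ ((1 : ℝ) / 2)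
          * deriv (fun x => R (x, t)) q) ^ 2 = 0 := by
  have dL : ∀ p ∈ Ω, ContDiffAt ℝ (⊤ : ℕ∞) L p := fun p h => hL.contDiffAt (hΩ.mem_nhds h)
  have dR : ∀ p ∈ Ω, ContDiffAt ℝ (⊤ : ℕ∞) R p := by
    intro p h
    have hL' := dL p h
    have ha' := ha.contDiffAt (x := p)
    have hb' := hb.contDiffAt (x := p)
    have hc' := hc.contDiffAt (x := p)
    have : R = fun p => L p ^ 4 / 4 + a p * L p ^ 2 + b p * L p + c p := funext hR
    rw [this]
    fun_prop
  have da : ∀ p, DifferentiableAt ℝ a p := fun p => ha.differentiable (by simp) p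
  have db : ∀ p, DifferentiableAt ℝ b p := fun p => hb.differentiable (by simp) p
  have dc : ∀ p, DifferentiableAt ℝ c p := fun p => hc.differentiable (by simp) p
  have eL : ∀ p ∈ Ω, DifferentiableAt ℝ L p := fun p h => (dL p h).differentiableAt (by simp)
  have eR : ∀ p ∈ Ω, DifferentiableAt ℝ R p := fun p h => (dR p h).differentiableAt (by simp)
  -- first derivatives of R
  have Rq : ∀ p ∈ Ω, fderiv ℝ R p (1, 0) = fderiv ℝ a p (1, 0) * L p ^ 2
      + fderiv ℝ b p (1, 0) * L p + fderiv ℝ c p (1, 0) := by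
    rintro ⟨x, y⟩ h
    have h1 := slice_q (eR _ h)
    have hl := slice_q (eL _ h)
    have h2 := ((((hl.pow 4).div_const 4).add ((slice_q (da (x, y))).mul (hl.pow 2))).add
      ((slice_q (db (x, y))).mul hl)).add (slice_q (dc (x, y)))
    have h3 := h1.unique (h2.congr_of_eventuallyEq (Filter.Eventually.of_forall fun x => by
      simp [hR]))
    have := hroot _ h
    rw [h3]
    simp
    linear_combination (fderiv ℝ L (x, y) (1, 0)) * this
  have Rt : ∀ p ∈ Ω, fderiv ℝ R p (0, 1) = fderiv ℝ a p (0, 1) * L p ^ 2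
      + fderiv ℝ b p (0, 1) * L p + fderiv ℝ c p (0, 1) := by
    rintro ⟨x, y⟩ h
    have h1 := slice_t (eR _ h)
    have hl := slice_t (eL _ h)
    have h2 := ((((hl.pow 4).div_const 4).add ((slice_t (da (x, y))).mul (hl.pow 2))).add
      ((slice_t (db (x, y))).mul hl)).add (slice_t (dc (x, y)))
    have h3 := h1.unique (h2.congr_of_eventuallyEq (Filter.Eventually.of_forall fun x => by
      simp [hR]))
    have := hroot _ h
    rw [h3]
    simp
    linear_combination (fderiv ℝ L (x, y) (0, 1)) * this
  have RT : ∀ p ∈ Ω, fderiv ℝ R p (0, 1) = - (L p * fderiv ℝ R p (1, 0)) := by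
    intro p h
    rw [Rq p h, Rt p h]
    linear_combination L p ^ 2 * s1 p + L p * s2 p + s3 p + fderiv ℝ a p (1, 0) * hroot p h
  -- derivatives of L
  have Lq : (3 * L (q, t) ^ 2 + 2 * a (q, t)) * fderiv ℝ L (q, t) (1, 0)
      + 2 * fderiv ℝ a (q, t) (1, 0) * L (q, t) + fderiv ℝ b (q, t) (1, 0) = 0 := by
    have hl := slice_q (eL _ hp)
    have h2 := ((hl.pow 3).add (((slice_q (da (q, t))).const_mul 2).mul hl)).add
      (slice_q (db (q, t)))
    have h3 := (hasDerivAt_const q (0 : ℝ)).unique (h2.congr_of_eventuallyEq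
      ((nhds_q hΩ hp).mono fun x hx => by simp [hroot _ hx]))
    simp at h3
    linear_combination -h3
  have Lt : (3 * L (q, t) ^ 2 + 2 * a (q, t)) * fderiv ℝ L (q, t) (0, 1)
      + 2 * fderiv ℝ a (q, t) (0, 1) * L (q, t) + fderiv ℝ b (q, t) (0, 1) = 0 := by
    have hl := slice_t (eL _ hp)
    have h2 := ((hl.pow 3).add (((slice_t (da (q, t))).const_mul 2).mul hl)).add
      (slice_t (db (q, t)))
    have h3 := (hasDerivAt_const t (0 : ℝ)).unique (h2.congr_of_eventuallyEq
      ((nhds_t hΩ hp).mono fun x hx => by simp [hroot _ hx]))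
    simp at h3
    linear_combination -h3
  -- second derivatives of R
  have h22 : (2 : WithTop ℕ∞) ≤ ((⊤ : ℕ∞) : WithTop ℕ∞) := by
    change ((2 : ℕ∞) : WithTop ℕ∞) ≤ _
    exact WithTop.coe_le_coe.2 le_top
  have dd : DifferentiableAt ℝ (fderiv ℝ R) (q, t) :=
    ((dR _ hp).fderiv_right (m := 1) (by rw [one_add_one_eq_two]; exact h22)).differentiableAt (by simp)
  have sym := ((dR _ hp).isSymmSndFDerivAt (by simpa using h22)) (0, 1) (1, 0)
  have dW : ∀ v, DifferentiableAt ℝ (fun p => fderiv ℝ R p v) (q, t) := fun v =>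
    dd.clm_apply (differentiableAt_const v)
  have fW : ∀ v w, fderiv ℝ (fun p => fderiv ℝ R p v) (q, t) w
      = fderiv ℝ (fderiv ℝ R) (q, t) w v := by
    intro v w
    rw [fderiv_clm_apply dd (differentiableAt_const v)]
    simp
  have Wq := slice_q (dW (1, 0))
  have Wt := slice_t (dW (1, 0))
  have Tq := slice_q (dW (0, 1))
  have h4 := Tq.unique (((slice_q (eL _ hp)).mul Wq).neg.congr_of_eventuallyEq
      ((nhds_q hΩ hp).mono fun x hx => by simp [RT _ hx]))
  rw [fW] at Wq Wt
  rw [fW, fW] at h4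
  rw [sym, h4] at Wt
  have hA0 := hA _ hp
  have Aq := abs_half ((((slice_q (eL _ hp)).pow 2).const_mul 3).add
    ((slice_q (da (q, t))).const_mul 2)) (by simpa using hA0)
  have At := abs_half ((((slice_t (eL _ hp)).pow 2).const_mul 3).add
    ((slice_t (da (q, t))).const_mul 2)) (by simpa using hA0)
  have Zq := (Aq.mul Wq).congr_of_eventuallyEq
    (f₁ := fun y => |3 * L (y, t) ^ 2 + 2 * a (y, t)| ^ ((1 : ℝ) / 2)
        * deriv (fun x => R (x, t)) y)
    ((nhds_q hΩ hp).mono fun x hx => by simp [(slice_q (eR _ hx)).deriv])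
  have Zt := (At.mul Wt).congr_of_eventuallyEq
    (f₁ := fun s => |3 * L (q, s) ^ 2 + 2 * a (q, s)| ^ ((1 : ℝ) / 2)
        * deriv (fun x => R (x, s)) q)
    ((nhds_t hΩ hp).mono fun x hx => by simp [(slice_q (eR _ hx)).deriv])
  rw [Zq.deriv, Zt.deriv, (slice_q (eR _ hp)).deriv]
  have hpos := abs_pos.mpr hA0
  have h5 : |3 * L (q, t) ^ 2 + 2 * a (q, t)| ^ ((5 : ℝ) / 2)
      = |3 * L (q, t) ^ 2 + 2 * a (q, t)| ^ ((1 : ℝ) / 2) * (3 * L (q, t) ^ 2 + 2 * a (q, t)) ^ 2 := by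
    rw [← sq_abs (3 * L (q, t) ^ 2 + 2 * a (q, t))]
    generalize |3 * L (q, t) ^ 2 + 2 * a (q, t)| = B at *
    rw [← Real.rpow_natCast, ← Real.rpow_add hpos]
    norm_num
  have hS : |3 * L (q, t) ^ 2 + 2 * a (q, t)| ^ ((1 : ℝ) / 2) ≠ 0 :=
    (Real.rpow_pos_of_pos hpos _).ne'
  have hw := Rq _ hp
  have e1 := s1 (q, t)
  have e2 := s2 (q, t)
  rw [h5]
  simp only [Pi.add_apply, Pi.mul_apply, Pi.pow_apply]
  generalize fderiv ℝ (fderiv ℝ R) (q, t) (1, 0) (1, 0) = Wqq at *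
  generalize |3 * L (q, t) ^ 2 + 2 * a (q, t)| ^ ((1 : ℝ) / 2) = S at *
  generalize fderiv ℝ R (q, t) (1, 0) = W at *
  generalize fderiv ℝ L (q, t) (1, 0) = lq at *
  generalize fderiv ℝ L (q, t) (0, 1) = lt at *
  generalize fderiv ℝ a (q, t) (1, 0) = aq at *
  generalize fderiv ℝ a (q, t) (0, 1) = at' at *
  generalize fderiv ℝ b (q, t) (1, 0) = bq at *
  generalize fderiv ℝ b (q, t) (0, 1) = bt at *
  generalize fderiv ℝ c (q, t) (1, 0) = cq at *
  generalize L (q, t) = l at *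
  generalize a (q, t) = α at *
  clear Zq Zt Aq At Wq Wt h4 h5
  have k1 : lt = (-2 * at' * l - bt) / (3 * l ^ 2 + 2 * α) := by
    rw [eq_div_iff hA0]; linear_combination Lt
  have k2 : lq = (-2 * aq * l - bq) / (3 * l ^ 2 + 2 * α) := by
    rw [eq_div_iff hA0]; linear_combination Lq
  have k3 : at' = -bq := by linear_combination e1
  have k4 : bt = 2 * α * aq - cq := by linear_combination e2
  have k5 : cq = W - aq * l ^ 2 - bq * l := by linear_combination -hw
  rw [k1, k2, k3, k4, k5]
  push_cast
  field_simp
  ring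

/-- blow-up equation along characteristics, n = 3: in the
strictly hyperbolic region, `z_i = |F_pp(λ_i)|^{1/2} ∂_q r_i` satisfies the
Riccati-type equation `∂_t z_i + λ_i ∂_q z_i + K_i z_i² = 0` with
`K_i = -3λ_i / |F_pp(λ_i)|^{5/2}`. -/
theorem blow_up_equation_along_characteristics
    (u₁ u₂ u₃ : ℝ → ℝ → ℝ)
    (hu₁ : ContDiff ℝ (⊤ : ℕ∞) (fun z : ℝ × ℝ => u₁ z.1 z.2))
    (hu₂ : ContDiff ℝ (⊤ : ℕ∞) (fun z : ℝ × ℝ => u₂ z.1 z.2))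
    (hu₃ : ContDiff ℝ (⊤ : ℕ∞) (fun z : ℝ × ℝ => u₃ z.1 z.2))
    (hq₁ : ∀ t, Function.Periodic (fun q => u₁ q t) 1)
    (hq₂ : ∀ t, Function.Periodic (fun q => u₂ q t) 1)
    (hq₃ : ∀ t, Function.Periodic (fun q => u₃ q t) 1)
    (ht₁ : ∀ q, Function.Periodic (fun t => u₁ q t) 1)
    (ht₂ : ∀ q, Function.Periodic (fun t => u₂ q t) 1)
    (ht₃ : ∀ q, Function.Periodic (fun t => u₃ q t) 1)
    (hsys₁ : ∀ q t, deriv (fun s => u₁ q s) t + deriv (fun x => u₂ x t) q = 0)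
    (hsys₂ : ∀ q t, deriv (fun s => u₂ q s) t + deriv (fun x => u₃ x t) q
        - 2 * u₁ q t * deriv (fun x => u₁ x t) q = 0)
    (hsys₃ : ∀ q t, deriv (fun s => u₃ q s) t - u₂ q t * deriv (fun x => u₁ x t) q = 0)
    (Ωh : Set (ℝ × ℝ)) (hΩh_open : IsOpen Ωh)
    (hΩh : ∀ z : ℝ × ℝ, z ∈ Ωh ↔ ∃ a b c : ℝ, a < b ∧ b < c ∧
      a ^ 3 + 2 * u₁ z.1 z.2 * a + u₂ z.1 z.2 = 0 ∧
      b ^ 3 + 2 * u₁ z.1 z.2 * b + u₂ z.1 z.2 = 0 ∧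
      c ^ 3 + 2 * u₁ z.1 z.2 * c + u₂ z.1 z.2 = 0)
    (lam : Fin 3 → ℝ → ℝ → ℝ)
    (hlam : ∀ i, ContDiffOn ℝ (⊤ : ℕ∞) (fun z : ℝ × ℝ => lam i z.1 z.2) Ωh)
    (horder : ∀ q t, (q, t) ∈ Ωh → lam 0 q t < lam 1 q t ∧ lam 1 q t < lam 2 q t)
    (hroot : ∀ q t, (q, t) ∈ Ωh → ∀ i : Fin 3,
      (lam i q t) ^ 3 + 2 * u₁ q t * lam i q t + u₂ q t = 0)
    (r : Fin 3 → ℝ → ℝ → ℝ)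
    (hr : ∀ i q t, r i q t = (lam i q t) ^ 4 / 4 + u₁ q t * (lam i q t) ^ 2
      + u₂ q t * lam i q t + u₃ q t)
    (z : Fin 3 → ℝ → ℝ → ℝ)
    (hz : ∀ i q t, z i q t =
      |3 * (lam i q t) ^ 2 + 2 * u₁ q t| ^ ((1 : ℝ) / 2) * deriv (fun x => r i x t) q)
    (K : Fin 3 → ℝ → ℝ → ℝ)
    (hK : ∀ i q t, K i q t =
      -3 * lam i q t / |3 * (lam i q t) ^ 2 + 2 * u₁ q t| ^ ((5 : ℝ) / 2)) :
    ∀ q t, (q, t) ∈ Ωh → ∀ i : Fin 3,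
      deriv (fun s => z i q s) t + lam i q t * deriv (fun x => z i x t) q
        + K i q t * z i q t ^ 2 = 0 := by
  intro q t hp i
  have hA : ∀ p ∈ Ωh, 3 * lam i p.1 p.2 ^ 2 + 2 * u₁ p.1 p.2 ≠ 0 := by
    rintro ⟨x, y⟩ h
    obtain ⟨o1, o2⟩ := horder x y h
    have r0 := hroot x y h 0
    have r1 := hroot x y h 1
    have r2 := hroot x y h 2
    have d01 := sub_ne_zero.mpr o1.ne
    have d12 := sub_ne_zero.mpr o2.ne
    have d02 := sub_ne_zero.mpr (o1.trans o2).ne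
    have f01 : lam 0 x y ^ 2 + lam 0 x y * lam 1 x y + lam 1 x y ^ 2 + 2 * u₁ x y = 0 :=
      mul_left_cancel₀ d01 (by linear_combination r0 - r1)
    have f12 : lam 1 x y ^ 2 + lam 1 x y * lam 2 x y + lam 2 x y ^ 2 + 2 * u₁ x y = 0 :=
      mul_left_cancel₀ d12 (by linear_combination r1 - r2)
    have hs : lam 0 x y + lam 1 x y + lam 2 x y = 0 :=
      mul_left_cancel₀ d02 (by linear_combination f01 - f12)
    have h2 : lam 2 x y = - lam 0 x y - lam 1 x y := by linear_combination hs
    rw [h2] at d12 d02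
    fin_cases i
    · have : 3 * lam 0 x y ^ 2 + 2 * u₁ x y
          = (lam 0 x y - lam 1 x y) * (lam 0 x y - (- lam 0 x y - lam 1 x y)) := by
        linear_combination f01
      simpa [this] using ⟨d01, d02⟩
    · have : 3 * lam 1 x y ^ 2 + 2 * u₁ x y
          = -(lam 0 x y - lam 1 x y) * (lam 1 x y - (- lam 0 x y - lam 1 x y)) := by
        linear_combination f01
      have := this ▸ mul_ne_zero (neg_ne_zero.mpr d01) d12
      exact this
    · have : 3 * lam 2 x y ^ 2 + 2 * u₁ x y
          = (lam 0 x y - (- lam 0 x y - lam 1 x y)) * (lam 1 x y - (- lam 0 x y - lam 1 x y)) := by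
        rw [h2]
        linear_combination f01
      have := this ▸ mul_ne_zero d02 d12
      exact this
  have D1 : Differentiable ℝ (fun z : ℝ × ℝ => u₁ z.1 z.2) := hu₁.differentiable (by simp)
  have D2 : Differentiable ℝ (fun z : ℝ × ℝ => u₂ z.1 z.2) := hu₂.differentiable (by simp)
  have D3 : Differentiable ℝ (fun z : ℝ × ℝ => u₃ z.1 z.2) := hu₃.differentiable (by simp)
  have main := core Ωh hΩh_open (fun z => u₁ z.1 z.2) (fun z => u₂ z.1 z.2)
    (fun z => u₃ z.1 z.2) (fun z => lam i z.1 z.2) (fun z => r i z.1 z.2) hu₁ hu₂ hu₃ (hlam i)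
    (by
      rintro ⟨x, y⟩
      rw [← (slice_t (D1 (x, y))).deriv, ← (slice_q (D2 (x, y))).deriv]
      exact hsys₁ x y)
    (by
      rintro ⟨x, y⟩
      rw [← (slice_t (D2 (x, y))).deriv, ← (slice_q (D3 (x, y))).deriv,
        ← (slice_q (D1 (x, y))).deriv]
      exact hsys₂ x y)
    (by
      rintro ⟨x, y⟩
      rw [← (slice_t (D3 (x, y))).deriv, ← (slice_q (D1 (x, y))).deriv]
      exact hsys₃ x y)
    (fun p h => hroot p.1 p.2 h i) hA (fun p => hr i p.1 p.2) q t hp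
  simp only [hz, hK]
  exact main
end

section
/- Let u₁, u₂, u₃ be a smooth periodic solution of the quasi-linear system. On the elliptic region Ω_e define the real and imaginary parts of the complex Riemann invariant by v + i w = F(α + iβ, q, t) (where F is evaluated at the complex root α + iβ of ∂_p F). Then v and w satisfy the elliptic first-order system ∂_t v + α ∂_q v − β ∂_q w = 0 and ∂_t w + β ∂_q v + α ∂_q w = 0 on Ω_e. -/
open Complex in
theorem aux_curve (a b c₁ c₂ c₃ f g : ℝ → ℝ) (s : ℝ)
    (ha : DifferentiableAt ℝ a s) (hb : DifferentiableAt ℝ b s)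
    (h₁ : DifferentiableAt ℝ c₁ s) (h₂ : DifferentiableAt ℝ c₂ s)
    (h₃ : DifferentiableAt ℝ c₃ s)
    (hr : ((a s : ℂ) + b s * I) ^ 3 + 2 * (c₁ s : ℂ) * ((a s : ℂ) + b s * I) + (c₂ s : ℂ) = 0)
    (hf : ∀ x, f x = (((a x : ℂ) + b x * I) ^ 4 / 4 + (c₁ x : ℂ) * ((a x : ℂ) + b x * I) ^ 2
      + (c₂ x : ℂ) * ((a x : ℂ) + b x * I) + (c₃ x : ℂ)).re)
    (hg : ∀ x, g x = (((a x : ℂ) + b x * I) ^ 4 / 4 + (c₁ x : ℂ) * ((a x : ℂ) + b x * I) ^ 2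
      + (c₂ x : ℂ) * ((a x : ℂ) + b x * I) + (c₃ x : ℂ)).im) :
    ((deriv f s : ℝ) : ℂ) + ((deriv g s : ℝ) : ℂ) * I = ((deriv c₁ s : ℝ) : ℂ) * ((a s : ℂ) + b s * I) ^ 2
      + ((deriv c₂ s : ℝ) : ℂ) * ((a s : ℂ) + b s * I) + ((deriv c₃ s : ℝ) : ℂ) := by
  have hP : HasDerivAt (fun x => (a x : ℂ) + b x * I) (((deriv a s : ℝ) : ℂ) + ((deriv b s : ℝ) : ℂ) * I) s :=
    ha.hasDerivAt.ofReal_comp.add (hb.hasDerivAt.ofReal_comp.mul_const I)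
  have hG := ((((hP.pow 4).div_const 4).add
    (h₁.hasDerivAt.ofReal_comp.mul (hP.pow 2))).add
    (h₂.hasDerivAt.ofReal_comp.mul hP)).add h₃.hasDerivAt.ofReal_comp
  have e1 := (reCLM.hasFDerivAt.comp_hasDerivAt s hG).congr_of_eventuallyEq
    (f₁ := f) (Filter.Eventually.of_forall fun x => by simp [hf])
  have e2 := (imCLM.hasFDerivAt.comp_hasDerivAt s hG).congr_of_eventuallyEq
    (f₁ := g) (Filter.Eventually.of_forall fun x => by simp [hg])
  rw [e1.deriv, e2.deriv, reCLM_apply, imCLM_apply, re_add_im]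
  simp only [Pi.pow_apply]
  push_cast
  linear_combination (((deriv a s : ℝ) : ℂ) + ((deriv b s : ℝ) : ℂ) * I) * hr

open Complex in
/-- on the elliptic region, the real and imaginary parts of the
complex Riemann invariant `v + i w = F(α + iβ, q, t)` satisfy the first-order
elliptic system `∂_t v + α ∂_q v - β ∂_q w = 0`, `∂_t w + β ∂_q v + α ∂_q w = 0`. -/
theorem elliptic_system_for_complex_riemann_invariant
    (u₁ u₂ u₃ : ℝ → ℝ → ℝ)
    (hu₁ : ContDiff ℝ (⊤ : ℕ∞) (fun z : ℝ × ℝ => u₁ z.1 z.2))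
    (hu₂ : ContDiff ℝ (⊤ : ℕ∞) (fun z : ℝ × ℝ => u₂ z.1 z.2))
    (hu₃ : ContDiff ℝ (⊤ : ℕ∞) (fun z : ℝ × ℝ => u₃ z.1 z.2))
    (hq₁ : ∀ t, Function.Periodic (fun q => u₁ q t) 1)
    (hq₂ : ∀ t, Function.Periodic (fun q => u₂ q t) 1)
    (hq₃ : ∀ t, Function.Periodic (fun q => u₃ q t) 1)
    (ht₁ : ∀ q, Function.Periodic (fun t => u₁ q t) 1)
    (ht₂ : ∀ q, Function.Periodic (fun t => u₂ q t) 1)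
    (ht₃ : ∀ q, Function.Periodic (fun t => u₃ q t) 1)
    (hsys₁ : ∀ q t, deriv (fun s => u₁ q s) t + deriv (fun x => u₂ x t) q = 0)
    (hsys₂ : ∀ q t, deriv (fun s => u₂ q s) t + deriv (fun x => u₃ x t) q
        - 2 * u₁ q t * deriv (fun x => u₁ x t) q = 0)
    (hsys₃ : ∀ q t, deriv (fun s => u₃ q s) t - u₂ q t * deriv (fun x => u₁ x t) q = 0)
    (Ωe : Set (ℝ × ℝ)) (hΩe_open : IsOpen Ωe)
    (hΩe : ∀ z : ℝ × ℝ, z ∈ Ωe ↔ ∃ a b : ℝ, 0 < b ∧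
      ((a : ℂ) + b * I) ^ 3 + 2 * (u₁ z.1 z.2 : ℂ) * ((a : ℂ) + b * I)
        + (u₂ z.1 z.2 : ℂ) = 0)
    (α β : ℝ → ℝ → ℝ)
    (hα : ContDiffOn ℝ (⊤ : ℕ∞) (fun z : ℝ × ℝ => α z.1 z.2) Ωe)
    (hβ : ContDiffOn ℝ (⊤ : ℕ∞) (fun z : ℝ × ℝ => β z.1 z.2) Ωe)
    (hβpos : ∀ q t, (q, t) ∈ Ωe → 0 < β q t)
    (hroot : ∀ q t, (q, t) ∈ Ωe →
      ((α q t : ℂ) + β q t * I) ^ 3 + 2 * (u₁ q t : ℂ) * ((α q t : ℂ) + β q t * I)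
        + (u₂ q t : ℂ) = 0)
    (v w : ℝ → ℝ → ℝ)
    (hv : ∀ q t, v q t = (((α q t : ℂ) + β q t * I) ^ 4 / 4
      + (u₁ q t : ℂ) * ((α q t : ℂ) + β q t * I) ^ 2
      + (u₂ q t : ℂ) * ((α q t : ℂ) + β q t * I) + (u₃ q t : ℂ)).re)
    (hw : ∀ q t, w q t = (((α q t : ℂ) + β q t * I) ^ 4 / 4
      + (u₁ q t : ℂ) * ((α q t : ℂ) + β q t * I) ^ 2
      + (u₂ q t : ℂ) * ((α q t : ℂ) + β q t * I) + (u₃ q t : ℂ)).im) :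
    ∀ q t, (q, t) ∈ Ωe →
      deriv (fun s => v q s) t + α q t * deriv (fun x => v x t) q
        - β q t * deriv (fun x => w x t) q = 0 ∧
      deriv (fun s => w q s) t + β q t * deriv (fun x => v x t) q
        + α q t * deriv (fun x => w x t) q = 0 := by
  intro q t hz
  have nh : Ωe ∈ nhds (q, t) := hΩe_open.mem_nhds hz
  have key : ∀ h : ℝ → ℝ → ℝ, DifferentiableAt ℝ (fun z : ℝ × ℝ => h z.1 z.2) (q, t) →
      DifferentiableAt ℝ (fun s => h q s) t ∧ DifferentiableAt ℝ (fun x => h x t) q := by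
    intro h hd
    constructor
    · exact DifferentiableAt.comp (f := fun s : ℝ => (q, s)) t hd (by fun_prop)
    · exact DifferentiableAt.comp (f := fun x : ℝ => (x, t)) q hd (by fun_prop)
  have ka := key α ((hα.contDiffAt nh).differentiableAt (by simp))
  have kb := key β ((hβ.contDiffAt nh).differentiableAt (by simp))
  have k1 := key u₁ (hu₁.contDiffAt.differentiableAt (by simp))
  have k2 := key u₂ (hu₂.contDiffAt.differentiableAt (by simp))
  have k3 := key u₃ (hu₃.contDiffAt.differentiableAt (by simp))
  have hr := hroot q t hz
  have et := aux_curve _ _ _ _ _ (fun s => v q s) (fun s => w q s) t ka.1 kb.1 k1.1 k2.1 k3.1 hr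
    (fun s => hv q s) (fun s => hw q s)
  have eq := aux_curve _ _ _ _ _ (fun x => v x t) (fun x => w x t) q ka.2 kb.2 k1.2 k2.2 k3.2 hr
    (fun x => hv x t) (fun x => hw x t)
  have s1 := congrArg (fun x : ℝ => (x : ℂ)) (hsys₁ q t)
  have s2 := congrArg (fun x : ℝ => (x : ℂ)) (hsys₂ q t)
  have s3 := congrArg (fun x : ℝ => (x : ℂ)) (hsys₃ q t)
  push_cast at s1 s2 s3
  generalize deriv (fun s => v q s) t = vt at *
  generalize deriv (fun s => w q s) t = wt at *
  generalize deriv (fun x => v x t) q = vq at *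
  generalize deriv (fun x => w x t) q = wq at *
  have main : ((vt : ℂ) + wt * I) + ((α q t : ℂ) + β q t * I) * ((vq : ℂ) + wq * I) = 0 := by
    rw [et, eq]
    linear_combination ((deriv (fun x => u₁ x t) q : ℝ) : ℂ) * hr
      + ((α q t : ℂ) + β q t * I) ^ 2 * s1 + ((α q t : ℂ) + β q t * I) * s2 + s3
  have m1 := congrArg re main
  have m2 := congrArg im main
  simp at m1 m2
  constructor <;> linarith
end

section
/- Let u : ℝ² → ℝ be a smooth potential, periodic of period 1 in q and in t, and suppose F(p,q,t) = Σ_{k=−1}^{n} u_k(q,t) p^{n−k} is a polynomial of degree n+1 in p with smooth coefficients u_{−1}, u₀, u₁, …, u_n, each periodic of period 1 in q and in t, which satisfies the conservation equation ∂_t F + p ∂_q F − (∂_q u) ∂_p F = 0 identically in p. Then the leading coefficients u_{−1} and u₀ are constant functions, and ∂_q u₁ = (n+1) · u_{−1} · ∂_q u (so that after normalizing u_{−1} = 1/(n+1), the coefficient u₁ differs from the potential u only by a function of t). -/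
theorem aux_periodic (f : ℝ → ℝ) (hf : Differentiable ℝ f) (hp : Function.Periodic f 1) (k : ℝ)
    (h : ∀ x, deriv f x = k) : k = 0 := by
  have h1 : ∀ x, HasDerivAt (fun x => f x - k * x) 0 x := by
    intro x
    have h2 := (hf x).hasDerivAt.fun_sub ((hasDerivAt_id x).const_mul k)
    rw [h x] at h2
    simpa using h2
  have h3 := is_const_of_deriv_eq_zero (fun x => (h1 x).differentiableAt)
    (fun x => (h1 x).deriv) 1 0
  have h4 := hp 0
  simp at h3 h4
  linarith

open Polynomial in
theorem aux_coeff (n : ℕ) (hn : 1 ≤ n) (a b d : Fin (n + 2) → ℝ) (v : ℝ)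
    (h : ∀ p : ℝ, (∑ j : Fin (n + 2), a j * p ^ (n + 1 - (j : ℕ)))
      + p * (∑ j : Fin (n + 2), b j * p ^ (n + 1 - (j : ℕ)))
      - v * (∑ j : Fin (n + 2), d j * (((n + 1 - (j : ℕ) : ℕ) : ℝ) * p ^ (n + 1 - (j : ℕ) - 1)))
      = 0) :
    b 0 = 0 ∧ a 0 + b 1 = 0 ∧ a 1 + b 2 = (n + 1) * d 0 * v := by
  let P : ℝ[X] := (∑ j : Fin (n + 2), C (a j) * X ^ (n + 1 - (j : ℕ)))
      + (∑ j : Fin (n + 2), C (b j) * X ^ (n + 2 - (j : ℕ)))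
      - (∑ j : Fin (n + 2), C (v * d j * ((n + 1 - (j : ℕ) : ℕ) : ℝ)) * X ^ (n + 1 - (j : ℕ) - 1))
  have hP : P = 0 := by
    apply Polynomial.funext
    intro p
    rw [eval_zero, ← h p]
    simp only [P, eval_add, eval_sub, eval_finsetSum, eval_mul, eval_C, eval_pow, eval_X,
      Finset.mul_sum]
    congr 1
    · congr 1
      refine Finset.sum_congr rfl fun j _ => ?_
      have : n + 2 - (j : ℕ) = (n + 1 - (j : ℕ)) + 1 := by omega
      rw [this, pow_succ]; ring
    · refine Finset.sum_congr rfl fun j _ => ?_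
      ring
  have v0 : ((0 : Fin (n + 2)) : ℕ) = 0 := rfl
  have v1 : ((1 : Fin (n + 2)) : ℕ) = 1 := Nat.mod_eq_of_lt (show 1 < n + 2 by omega)
  have v2 : ((2 : Fin (n + 2)) : ℕ) = 2 := Nat.mod_eq_of_lt (show 2 < n + 2 by omega)
  have hco : ∀ m, P.coeff m = 0 := fun m => by rw [hP, coeff_zero]
  simp only [P, coeff_add, coeff_sub, finsetSum_coeff, coeff_C_mul, coeff_X_pow, mul_ite,
    mul_one, mul_zero] at hco
  have key : ∀ (f : Fin (n + 2) → ℝ) (m : ℕ) (e : Fin (n + 2) → ℕ) (i : Fin (n + 2)),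
      (∀ j : Fin (n + 2), m = e j ↔ (j : ℕ) = (i : ℕ)) →
      (∑ j, if m = e j then f j else 0) = f i := by
    intro f m e i hh
    rw [Finset.sum_eq_single i]
    · rw [if_pos ((hh i).2 rfl)]
    · intro j _ hj
      rw [if_neg]
      intro h'
      exact hj (Fin.ext ((hh j).1 h'))
    · simp
  have key0 : ∀ (f : Fin (n + 2) → ℝ) (m : ℕ) (e : Fin (n + 2) → ℕ),
      (∀ j : Fin (n + 2), m ≠ e j) → (∑ j, if m = e j then f j else 0) = 0 := by
    intro f m e hh
    exact Finset.sum_eq_zero fun j _ => if_neg (hh j)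
  refine ⟨?_, ?_, ?_⟩
  · have := hco (n + 2)
    rw [key0 _ _ _ (by intro j; omega), key _ _ _ 0 (by intro j; rw [v0]; omega),
      key0 _ _ _ (by intro j; omega)] at this
    linarith
  · have := hco (n + 1)
    rw [key _ _ _ 0 (by intro j; rw [v0]; omega), key _ _ _ 1 (by intro j; rw [v1]; omega),
      key0 _ _ _ (by intro j; omega)] at this
    linarith
  · have := hco n
    rw [key _ _ _ 1 (by intro j; rw [v1]; omega), key _ _ _ 2 (by intro j; rw [v2]; omega),
      key _ _ _ 0 (by intro j; rw [v0]; omega), v0] at this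
    push_cast [Nat.sub_zero] at this
    linarith

/-- for a polynomial first integral
`F = ∑_{k=-1}^{n} u_k p^{n-k}` of `H = p²/2 + u(q,t)` with periodic smooth
coefficients, the leading coefficients `u₋₁` and `u₀` are constants and
`∂_q u₁ = (n+1) u₋₁ ∂_q u`.  The coefficient `u_k` is encoded as `c (k+1)`,
`c : Fin (n+2) → ℝ → ℝ → ℝ`. -/
theorem leading_coefficients_of_polynomial_integral
    (n : ℕ) (hn : 1 ≤ n)
    (u : ℝ → ℝ → ℝ)
    (hu : ContDiff ℝ (⊤ : ℕ∞) (fun z : ℝ × ℝ => u z.1 z.2))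
    (huq : ∀ t, Function.Periodic (fun q => u q t) 1)
    (hut : ∀ q, Function.Periodic (fun t => u q t) 1)
    (c : Fin (n + 2) → ℝ → ℝ → ℝ)
    (hc : ∀ j, ContDiff ℝ (⊤ : ℕ∞) (fun z : ℝ × ℝ => c j z.1 z.2))
    (hcq : ∀ j t, Function.Periodic (fun q => c j q t) 1)
    (hct : ∀ j q, Function.Periodic (fun t => c j q t) 1)
    (F : ℝ → ℝ → ℝ → ℝ)
    (hF : ∀ p q t, F p q t = ∑ j : Fin (n + 2), c j q t * p ^ (n + 1 - (j : ℕ)))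
    (hcons : ∀ p q t,
      deriv (fun s => F p q s) t + p * deriv (fun x => F p x t) q
        - deriv (fun x => u x t) q * deriv (fun y => F y q t) p = 0) :
    (∃ a : ℝ, ∀ q t, c 0 q t = a) ∧
    (∃ b : ℝ, ∀ q t, c 1 q t = b) ∧
    (∀ q t, deriv (fun x => c 2 x t) q
      = ((n : ℝ) + 1) * c 0 q t * deriv (fun x => u x t) q) := by
  have dq : ∀ j t, Differentiable ℝ (fun q => c j q t) := fun j t =>
    ((hc j).differentiable (by simp)).comp (differentiable_id.prodMk (differentiable_const t))
  have dt : ∀ j q, Differentiable ℝ (fun t => c j q t) := fun j q =>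
    ((hc j).differentiable (by simp)).comp ((differentiable_const q).prodMk differentiable_id)
  have duq : ∀ t, Differentiable ℝ (fun q => u q t) := fun t =>
    (hu.differentiable (by simp)).comp (differentiable_id.prodMk (differentiable_const t))
  have main : ∀ q t, deriv (fun x => c 0 x t) q = 0 ∧
      deriv (fun s => c 0 q s) t + deriv (fun x => c 1 x t) q = 0 ∧
      deriv (fun s => c 1 q s) t + deriv (fun x => c 2 x t) q
        = (n + 1) * c 0 q t * deriv (fun x => u x t) q := by
    intro q t
    refine aux_coeff n hn (fun j => deriv (fun s => c j q s) t) (fun j => deriv (fun x => c j x t) q)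
      (fun j => c j q t) (deriv (fun x => u x t) q) ?_
    intro p
    have h := hcons p q t
    simp only [hF] at h
    have e1 : HasDerivAt (fun s => ∑ j : Fin (n + 2), c j q s * p ^ (n + 1 - (j : ℕ)))
        (∑ j : Fin (n + 2), deriv (fun s => c j q s) t * p ^ (n + 1 - (j : ℕ))) t :=
      HasDerivAt.fun_sum fun j _ => (dt j q t).hasDerivAt.mul_const _
    have e2 : HasDerivAt (fun x => ∑ j : Fin (n + 2), c j x t * p ^ (n + 1 - (j : ℕ)))
        (∑ j : Fin (n + 2), deriv (fun x => c j x t) q * p ^ (n + 1 - (j : ℕ))) q :=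
      HasDerivAt.fun_sum fun j _ => (dq j t q).hasDerivAt.mul_const _
    have e3 : HasDerivAt (fun y => ∑ j : Fin (n + 2), c j q t * y ^ (n + 1 - (j : ℕ)))
        (∑ j : Fin (n + 2), c j q t *
          (((n + 1 - (j : ℕ) : ℕ) : ℝ) * p ^ (n + 1 - (j : ℕ) - 1))) p :=
      HasDerivAt.fun_sum fun j _ => (hasDerivAt_pow _ p).const_mul _
    rw [e1.deriv, e2.deriv, e3.deriv] at h
    exact h
  have c0q : ∀ q t, c 0 q t = c 0 0 t := fun q t =>
    is_const_of_deriv_eq_zero (dq 0 t) (fun x => (main x t).1) q 0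
  have c0t : ∀ t, deriv (fun s => c 0 0 s) t = 0 := by
    intro t
    have := aux_periodic _ (dq 1 t) (hcq 1 t) (-deriv (fun s => c 0 0 s) t) (by
      intro x
      have h := (main x t).2.1
      simp only [c0q x] at h
      linarith)
    linarith
  have c1q' : ∀ q t, deriv (fun x => c 1 x t) q = 0 := by
    intro q t
    have h := (main q t).2.1
    simp only [c0q q] at h
    rw [c0t] at h
    linarith
  have c0c : ∀ q t, c 0 q t = c 0 0 0 := fun q t => by
    rw [c0q]; exact is_const_of_deriv_eq_zero (dt 0 0) c0t t 0
  have c1q : ∀ q t, c 1 q t = c 1 0 t := fun q t =>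
    is_const_of_deriv_eq_zero (dq 1 t) (fun x => c1q' x t) q 0
  have c1t : ∀ t, deriv (fun s => c 1 0 s) t = 0 := by
    intro t
    have := aux_periodic (fun x => c 2 x t - (n + 1) * c 0 0 0 * u x t)
      ((dq 2 t).sub ((duq t).const_mul _))
      (by
        intro x
        have h1 := hcq 2 t x
        have h2 := huq t x
        simp only at h1 h2 ⊢
        rw [h1, h2])
      (-deriv (fun s => c 1 0 s) t) (by
      intro x
      have h := (main x t).2.2
      simp only [c1q x, c0c x] at h
      have e := ((dq 2 t x).hasDerivAt.sub ((duq t x).hasDerivAt.const_mul ((n + 1) * c 0 0 0))).deriv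
      refine e.trans ?_
      linarith)
    linarith
  refine ⟨⟨_, c0c⟩, ⟨c 1 0 0, fun q t => ?_⟩, fun q t => ?_⟩
  · rw [c1q]; exact is_const_of_deriv_eq_zero (dt 1 0) c1t t 0
  · have h := (main q t).2.2
    simp only [c1q q] at h
    rw [c1t] at h
    linarith
end
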